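/- arXiv:math/0305349 — 11 statements merged into one kernel-verified Lean document; each statement's English description precedes it below -/
import Mathlib

section
/- Fix x ∈ V and let μ_n = p^n(x, ·). Then for every ε > 0, χ²(μ_n, π) ≤ ε for all n ≥ ∫_{4π(x)}^{4/ε} (1/(u ψ(u))) du. -/
open MeasureTheory Set
open scoped ENNReal Classical

namespace EvolvingSetsPaper

variable {V : Type*}

/-- `π(S) = ∑_{y ∈ S} π(y)`. -/
noncomputable def piS (pi : V → ℝ) (S : Set V) : ℝ := ∑' y : S, pi y

/-- `Q(S, y) = ∑_{s ∈ S} π(s) p(s, y)`. -/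
noncomputable def QS (pi : V → ℝ) (p : V → V → ℝ) (S : Set V) (y : V) : ℝ :=
  ∑' s : S, pi s * p s y

/-- `Q(S, A) = ∑_{s ∈ S, a ∈ A} π(s) p(s, a)`. -/
noncomputable def Qset (pi : V → ℝ) (p : V → V → ℝ) (S A : Set V) : ℝ :=
  ∑' a : A, QS pi p S a

/-- The conductance `Φ_S = Q(S, Sᶜ)/π(S)`. -/
noncomputable def cond (pi : V → ℝ) (p : V → V → ℝ) (S : Set V) : ℝ :=
  Qset pi p S Sᶜ / piS pi S

/-- The conductance profile `Φ(r)`, constant for `r > 1/2`. -/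
noncomputable def profile (pi : V → ℝ) (p : V → V → ℝ) (r : ℝ) : ℝ :=
  if r ≤ 1 / 2 then sInf (cond pi p '' {S : Set V | 0 < piS pi S ∧ piS pi S ≤ r})
  else sInf (cond pi p '' {S : Set V | 0 < piS pi S ∧ piS pi S ≤ 1 / 2})

/-- `n`-step transition probabilities. -/
noncomputable def pn (p : V → V → ℝ) : ℕ → V → V → ℝ
  | 0 => fun x y => if x = y then 1 else 0
  | n + 1 => fun x y => ∑' z, pn p n x z * p z y

/-- One step of the evolving set process with uniform value `u`:
`S̃ = {y : Q(S,y) ≥ u π(y)}`. -/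
def esStep (pi : V → ℝ) (p : V → V → ℝ) (S : Set V) (u : ℝ) : Set V :=
  {y | u * pi y ≤ QS pi p S y}

/-- `esE pi p n F S = E_S[F(S_n)]` for the evolving set process started at `S`,
driven by i.i.d. uniform variables on `[0,1]`. -/
noncomputable def esE (pi : V → ℝ) (p : V → V → ℝ) : ℕ → (Set V → ℝ) → Set V → ℝ
  | 0 => fun F S => F S
  | n + 1 => fun F S => ∫ u in (0:ℝ)..1, esE pi p n F (esStep pi p S u)

/-- `ψ(S) = 1 - E_S √(π(S̃)/π(S))`. -/
noncomputable def psiSet (pi : V → ℝ) (p : V → V → ℝ) (S : Set V) : ℝ :=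
  1 - ∫ u in (0:ℝ)..1, Real.sqrt (piS pi (esStep pi p S u) / piS pi S)

/-- The root profile `ψ(r)`, constant for `r > 1/2`. -/
noncomputable def rootProfile (pi : V → ℝ) (p : V → V → ℝ) (r : ℝ) : ℝ :=
  if r ≤ 1 / 2 then sInf (psiSet pi p '' {S : Set V | 0 < piS pi S ∧ piS pi S ≤ r})
  else sInf (psiSet pi p '' {S : Set V | 0 < piS pi S ∧ piS pi S ≤ 1 / 2})

/-- `φ_S = (1/(2π(S))) ∑_y min(Q(S,y), Q(Sᶜ,y))`. -/
noncomputable def phiS (pi : V → ℝ) (p : V → V → ℝ) (S : Set V) : ℝ :=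
  (1 / (2 * piS pi S)) * ∑' y, min (QS pi p S y) (QS pi p Sᶜ y)

/-- `S^♯ = S` if `π(S) ≤ 1/2`, else `Sᶜ`. -/
noncomputable def sharp (pi : V → ℝ) (S : Set V) : Set V :=
  if piS pi S ≤ 1 / 2 then S else Sᶜ

/-- `χ²(μ, π) = ∑_y π(y) (μ(y)/π(y) - 1)²`. -/
noncomputable def chiSq (pi : V → ℝ) (mu : V → ℝ) : ℝ :=
  ∑' y, pi y * (mu y / pi y - 1) ^ 2


set_option linter.unusedSectionVars false
structure Hyp (pi : V → ℝ) (p : V → V → ℝ) : Prop where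
  hp0 : ∀ x y, 0 ≤ p x y
  hp1 : ∀ x, HasSum (p x) 1
  pos : ∀ x, 0 < pi x
  hpi : HasSum pi 1
  stat : ∀ y, HasSum (fun x => pi x * p x y) (pi y)

noncomputable def ind (y : V) (S : Set V) : ℝ := if y ∈ S then 1 else 0

lemma ind_nonneg (y : V) (S : Set V) : 0 ≤ ind y S := by unfold ind; split_ifs <;> norm_num
lemma ind_le_one (y : V) (S : Set V) : ind y S ≤ 1 := by unfold ind; split_ifs <;> norm_num
lemma ind_abs (y : V) (S : Set V) : |ind y S| ≤ 1 := by
  rw [abs_of_nonneg (ind_nonneg y S)]; exact ind_le_one y S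
lemma ind_sq (y : V) (S : Set V) : ind y S ^ 2 = ind y S := by unfold ind; split_ifs <;> norm_num
lemma ind_compl (y : V) (S : Set V) : ind y Sᶜ = 1 - ind y S := by
  unfold ind; by_cases h : y ∈ S <;> simp [h]
lemma ind_mono (y : V) {S T : Set V} (h : S ⊆ T) : ind y S ≤ ind y T := by
  unfold ind; by_cases h1 : y ∈ S
  · simp [h1, h h1]
  · simp only [h1, if_false]; split_ifs <;> norm_num

lemma measurable_ind (y : V) : Measurable (ind y) :=
  Measurable.ite (measurableSet_mem y) measurable_const measurable_const

lemma piS_eq (pi : V → ℝ) (S : Set V) : piS pi S = ∑' y, pi y * ind y S := by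
  unfold piS
  rw [tsum_subtype S pi]
  congr 1; ext y; unfold ind; by_cases h : y ∈ S <;> simp [h]

lemma QS_eq (pi : V → ℝ) (p : V → V → ℝ) (S : Set V) (y : V) :
    QS pi p S y = ∑' s, pi s * p s y * ind s S := by
  unfold QS
  rw [tsum_subtype S (fun s => pi s * p s y)]
  congr 1; ext y; unfold ind; by_cases h : y ∈ S <;> simp [h]

lemma summable_mul_bdd {c f : V → ℝ} {C : ℝ} (hc : Summable c) (hc0 : ∀ y, 0 ≤ c y)
    (hf : ∀ y, |f y| ≤ C) : Summable (fun y => c y * f y) := by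
  refine Summable.of_norm_bounded (g := fun y => c y * C) (hc.mul_right C) fun y => ?_
  rw [Real.norm_eq_abs, abs_mul, abs_of_nonneg (hc0 y)]
  exact mul_le_mul_of_nonneg_left (hf y) (hc0 y)

namespace Hyp
variable {pi : V → ℝ} {p : V → V → ℝ}

lemma Q0 (h : Hyp pi p) (s y : V) : 0 ≤ pi s * p s y := mul_nonneg (h.pos s).le (h.hp0 s y)

lemma piS_hasSum (h : Hyp pi p) (S : Set V) : HasSum (fun y => pi y * ind y S) (piS pi S) := by
  rw [piS_eq]
  exact (summable_mul_bdd h.hpi.summable (fun y => (h.pos y).le) (fun y => ind_abs y S)).hasSum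

lemma QS_hasSum (h : Hyp pi p) (S : Set V) (y : V) :
    HasSum (fun s => pi s * p s y * ind s S) (QS pi p S y) := by
  rw [QS_eq]
  exact (summable_mul_bdd (h.stat y).summable (fun s => h.Q0 s y) (fun y => ind_abs y S)).hasSum

lemma piS_nonneg (h : Hyp pi p) (S : Set V) : 0 ≤ piS pi S :=
  (h.piS_hasSum S).nonneg fun y => mul_nonneg (h.pos y).le (ind_nonneg y S)

lemma piS_mono (h : Hyp pi p) {S T : Set V} (hST : S ⊆ T) : piS pi S ≤ piS pi T :=
  hasSum_le (fun y => mul_le_mul_of_nonneg_left (ind_mono y hST) (h.pos y).le)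
    (h.piS_hasSum S) (h.piS_hasSum T)

lemma piS_compl (h : Hyp pi p) (S : Set V) : piS pi Sᶜ = 1 - piS pi S := by
  refine (h.piS_hasSum Sᶜ).unique ?_
  have := h.hpi.sub (h.piS_hasSum S)
  simpa only [ind_compl, mul_sub, mul_one] using this

lemma piS_le_one (h : Hyp pi p) (S : Set V) : piS pi S ≤ 1 := by
  have := h.piS_nonneg Sᶜ; rw [h.piS_compl] at this; linarith

lemma QS_nonneg (h : Hyp pi p) (S : Set V) (y : V) : 0 ≤ QS pi p S y :=
  (h.QS_hasSum S y).nonneg fun s => mul_nonneg (h.Q0 s y) (ind_nonneg s S)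

lemma QS_compl (h : Hyp pi p) (S : Set V) (y : V) : QS pi p Sᶜ y = pi y - QS pi p S y := by
  refine (h.QS_hasSum Sᶜ y).unique ?_
  have := (h.stat y).sub (h.QS_hasSum S y)
  simpa only [ind_compl, mul_sub, mul_one] using this

lemma QS_le (h : Hyp pi p) (S : Set V) (y : V) : QS pi p S y ≤ pi y := by
  have := h.QS_nonneg Sᶜ y; rw [h.QS_compl] at this; linarith

lemma piS_singleton (_h : Hyp pi p) (x : V) : piS pi {x} = pi x := by
  unfold piS; simp

lemma piS_empty (_h : Hyp pi p) : piS pi ∅ = 0 := by unfold piS; simp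

lemma eq_empty_of_piS (h : Hyp pi p) {S : Set V} (hS : piS pi S = 0) : S = ∅ := by
  by_contra hne
  obtain ⟨y, hy⟩ := Set.nonempty_iff_ne_empty.2 hne
  have := h.piS_mono (Set.singleton_subset_iff.2 hy)
  rw [h.piS_singleton] at this
  linarith [h.pos y]

lemma esStep_empty (h : Hyp pi p) {u : ℝ} (hu : 0 < u) : esStep pi p ∅ u = ∅ := by
  ext y
  have : QS pi p ∅ y = 0 := by unfold QS; simp
  simp only [esStep, Set.mem_ofPred_eq, this, Set.mem_empty_iff_false, iff_false, not_le]
  exact mul_pos hu (h.pos y)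

variable [Countable V]

lemma measurable_piS : Measurable (piS pi) := by
  have : piS pi = fun S => ∑' y, pi y * ind y S := by ext S; exact piS_eq pi S
  rw [this]
  exact Measurable.tsum fun y => (measurable_ind y).const_mul _

lemma measurable_QS (y : V) : Measurable (fun S => QS pi p S y) := by
  simp_rw [QS_eq]
  exact Measurable.tsum fun s => (measurable_ind s).const_mul _

lemma measurable_esStep : Measurable (fun q : Set V × ℝ => esStep pi p q.1 q.2) := by
  rw [measurable_set_iff]
  intro y
  have : MeasurableSet {q : Set V × ℝ | q.2 * pi y ≤ QS pi p q.1 y} :=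
    measurableSet_le (measurable_snd.mul_const _) ((measurable_QS y).comp measurable_fst)
  exact measurableSet_setOfPred.1 this

lemma measurable_esStep_right (S : Set V) : Measurable (fun u : ℝ => esStep pi p S u) :=
  (measurable_esStep (pi := pi) (p := p)).comp (measurable_const.prodMk measurable_id)

lemma integrable_bdd {α : Type*} [MeasurableSpace α] (μ : Measure α) [IsFiniteMeasure μ]
    {f : α → ℝ} (hf : Measurable f) (C : ℝ) (hC : ∀ a, |f a| ≤ C) : Integrable f μ :=
  Integrable.of_bound hf.aestronglyMeasurable C (Filter.Eventually.of_forall hC)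

lemma integral_swap {α : Type*} [MeasurableSpace α] (μ : Measure α) [IsProbabilityMeasure μ]
    {c : V → ℝ} (hc : Summable c) (hc0 : ∀ y, 0 ≤ c y) {F : V → α → ℝ} {C : ℝ}
    (hF : ∀ y, Measurable (F y)) (hC : ∀ y a, |F y a| ≤ C) :
    HasSum (fun y => c y * ∫ a, F y a ∂μ) (∫ a, ∑' y, c y * F y a ∂μ) := by
  have hi : ∀ y, Integrable (fun a => c y * F y a) μ := fun y =>
    (integrable_bdd μ (hF y) C (hC y)).const_mul _
  have := hasSum_integral_of_summable_integral_norm (μ := μ) hi ?_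
  · simpa only [integral_const_mul] using this
  · refine Summable.of_nonneg_of_le (fun y => integral_nonneg fun a => norm_nonneg _) ?_
      (hc.mul_right C)
    intro y
    calc ∫ a, ‖c y * F y a‖ ∂μ ≤ ∫ a, c y * C ∂μ := by
          refine integral_mono (hi y).norm (integrable_const _) fun a => ?_
          simp only [Real.norm_eq_abs, abs_mul, abs_of_nonneg (hc0 y)]
          exact mul_le_mul_of_nonneg_left (hC y a) (hc0 y)
      _ = c y * C := by simp

/-- uniform measure -/
noncomputable def U : Measure ℝ := volume.restrict (Ioc 0 1)

instance : IsProbabilityMeasure U := ⟨by simp [U]⟩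

lemma integral_ind_step (h : Hyp pi p) (S : Set V) (y : V) :
    ∫ u, ind y (esStep pi p S u) ∂U = QS pi p S y / pi y := by
  have h1 : ∀ u, ind y (esStep pi p S u) = (Iic (QS pi p S y / pi y)).indicator (fun _ => (1:ℝ)) u := by
    intro u
    unfold ind esStep
    simp only [Set.mem_ofPred_eq, Set.indicator_apply, Set.mem_Iic, le_div_iff₀ (h.pos y)]
  simp_rw [h1]
  rw [integral_indicator measurableSet_Iic]
  have h0 : 0 ≤ QS pi p S y / pi y := div_nonneg (h.QS_nonneg S y) (h.pos y).le
  have h2 : QS pi p S y / pi y ≤ 1 := (div_le_one (h.pos y)).2 (h.QS_le S y)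
  rw [U, Measure.restrict_restrict measurableSet_Iic, Set.inter_comm, Set.Ioc_inter_Iic]
  simp [h0, h2]

lemma sum_QS (h : Hyp pi p) (S : Set V) : HasSum (QS pi p S) (piS pi S) := by
  have hs : Summable (fun q : V × V => pi q.1 * p q.1 q.2 * ind q.1 S) := by
    have hnn : 0 ≤ (fun q : V × V => pi q.1 * p q.1 q.2 * ind q.1 S) :=
      fun q => mul_nonneg (h.Q0 q.1 q.2) (ind_nonneg q.1 S)
    refine (summable_prod_of_nonneg hnn).2 ⟨fun s => ?_, ?_⟩
    · exact ((h.hp1 s).summable.mul_left (pi s)).mul_right (ind s S)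
    · have : ∀ s, ∑' y, pi s * p s y * ind s S = pi s * ind s S := fun s => by
        rw [tsum_mul_right, tsum_mul_left, (h.hp1 s).tsum_eq, mul_one]
      simp only [this]
      exact (h.piS_hasSum S).summable
  have h1 := hs.hasSum
  have h2 : HasSum (fun s => pi s * ind s S) (∑' q : V × V, pi q.1 * p q.1 q.2 * ind q.1 S) := by
    refine h1.prod_fiberwise (g := fun s => pi s * ind s S) fun s => ?_
    simpa using ((h.hp1 s).mul_left (pi s)).mul_right (ind s S)
  rw [h2.unique (h.piS_hasSum S)] at h1
  rw [← (Equiv.prodComm V V).hasSum_iff] at h1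
  exact h1.prod_fiberwise fun y => h.QS_hasSum S y

lemma integral_piS_step (h : Hyp pi p) (S : Set V) :
    ∫ u, piS pi (esStep pi p S u) ∂U = piS pi S := by
  simp_rw [piS_eq pi (esStep pi p S _)]
  refine (integral_swap U h.hpi.summable (fun y => (h.pos y).le)
    (F := fun y u => ind y (esStep pi p S u)) (C := 1)
    (fun y => (measurable_ind y).comp (measurable_esStep_right S))
    (fun y u => ind_abs _ _)).unique ?_
  convert h.sum_QS S using 1
  ext y
  rw [h.integral_ind_step, mul_div_cancel₀ _ (h.pos y).ne']

noncomputable def law (pi : V → ℝ) (p : V → V → ℝ) (x : V) : ℕ → Measure (Set V)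
  | 0 => Measure.dirac {x}
  | n + 1 => ((law pi p x n).prod U).map (fun q => esStep pi p q.1 q.2)

instance law_prob (x : V) (n : ℕ) : IsProbabilityMeasure (law pi p x n) := by
  induction n with
  | zero => unfold law; infer_instance
  | succ n ih =>
    unfold law
    exact Measure.isProbabilityMeasure_map measurable_esStep.aemeasurable

lemma integral_law_zero (x : V) {F : Set V → ℝ} (hF : Measurable F) :
    ∫ S, F S ∂(law pi p x 0) = F {x} := by
  unfold law
  exact integral_dirac' _ _ hF.stronglyMeasurable

lemma integral_law_succ (x : V) (n : ℕ) {F : Set V → ℝ} (hF : Measurable F) (C : ℝ)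
    (hC : ∀ S, |F S| ≤ C) :
    ∫ S, F S ∂(law pi p x (n+1)) = ∫ S, ∫ u, F (esStep pi p S u) ∂U ∂(law pi p x n) := by
  rw [law, integral_map measurable_esStep.aemeasurable hF.aestronglyMeasurable]
  exact integral_prod (fun q : Set V × ℝ => F (esStep pi p q.1 q.2))
    (integrable_bdd _ (hF.comp measurable_esStep) C (fun q => hC _))

lemma integrable_law_step (x : V) (n : ℕ) {F : Set V → ℝ} (hF : Measurable F) (C : ℝ)
    (hC : ∀ S, |F S| ≤ C) :
    Integrable (fun S => ∫ u, F (esStep pi p S u) ∂U) (law pi p x n) :=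
  (integrable_bdd ((law pi p x n).prod U) (hF.comp measurable_esStep) C
    (fun q => hC _)).integral_prod_left

lemma piS_abs (h : Hyp pi p) (S : Set V) : |piS pi S| ≤ 1 := by
  rw [abs_of_nonneg (h.piS_nonneg S)]; exact h.piS_le_one S

lemma integral_piS_law (h : Hyp pi p) (x : V) (n : ℕ) :
    ∫ S, piS pi S ∂(law pi p x n) = pi x := by
  induction n with
  | zero => rw [integral_law_zero x measurable_piS, h.piS_singleton]
  | succ n ih =>
    rw [integral_law_succ x n measurable_piS 1 h.piS_abs]
    simp_rw [h.integral_piS_step]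
    exact ih

lemma integral_ind_law (h : Hyp pi p) (x : V) (n : ℕ) (y : V) :
    ∫ S, ind y S ∂(law pi p x n) = pn p n x y * pi x / pi y := by
  induction n generalizing y with
  | zero =>
    rw [integral_law_zero x (measurable_ind y)]
    unfold ind pn
    by_cases hxy : y = x
    · subst hxy; simp [(h.pos y).ne']
    · simp [hxy, Ne.symm hxy]
  | succ n ih =>
    rw [integral_law_succ x n (measurable_ind y) 1 (ind_abs y)]
    simp_rw [h.integral_ind_step]
    rw [integral_div]
    simp_rw [QS_eq]
    rw [← (integral_swap (law pi p x n) (h.stat y).summable (fun s => h.Q0 s y)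
      (F := fun s S => ind s S) (C := 1) measurable_ind ind_abs).tsum_eq]
    simp_rw [ih]
    congr 1
    rw [pn, ← tsum_mul_right]
    congr 1; ext s
    have := (h.pos s).ne'
    field_simp

noncomputable def rt (pi : V → ℝ) (S : Set V) : ℝ := √(min (piS pi S) (1 - piS pi S))

lemma measurable_rt : Measurable (rt pi) :=
  (measurable_piS.min (measurable_const.sub measurable_piS)).sqrt

lemma rt_nonneg (S : Set V) : 0 ≤ rt pi S := Real.sqrt_nonneg _

lemma sqrt_abs_le {a : ℝ} (ha : a ≤ 1) : |√a| ≤ 1 := by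
  rw [abs_of_nonneg (Real.sqrt_nonneg _)]
  exact Real.sqrt_le_one.2 ha

lemma rt_abs (h : Hyp pi p) (S : Set V) : |rt pi S| ≤ 1 :=
  sqrt_abs_le ((min_le_left _ _).trans (h.piS_le_one S))

lemma measurable_sqrt_step (A : Set V) : Measurable fun u => √(piS pi (esStep pi p A u)) :=
  (measurable_piS.comp (measurable_esStep_right A)).sqrt

lemma integrable_sqrt_step (h : Hyp pi p) (A : Set V) :
    Integrable (fun u => √(piS pi (esStep pi p A u))) U :=
  integrable_bdd U (measurable_sqrt_step A) 1 fun u => sqrt_abs_le (h.piS_le_one _)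

lemma psiSet_eq (h : Hyp pi p) (A : Set V) :
    psiSet pi p A = 1 - (∫ u, √(piS pi (esStep pi p A u)) ∂U) / √(piS pi A) := by
  unfold psiSet
  rw [intervalIntegral.integral_of_le zero_le_one, ← integral_div]
  congr 1
  unfold U
  congr 1; ext u
  exact Real.sqrt_div (h.piS_nonneg _) _

lemma I_eq (h : Hyp pi p) {A : Set V} (hA : 0 < piS pi A) :
    ∫ u, √(piS pi (esStep pi p A u)) ∂U = √(piS pi A) * (1 - psiSet pi p A) := by
  rw [h.psiSet_eq]
  have := (Real.sqrt_pos.2 hA).ne'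
  field_simp
  ring

lemma psi_nonneg (h : Hyp pi p) {A : Set V} (hA : 0 < piS pi A) : 0 ≤ psiSet pi p A := by
  rw [h.psiSet_eq, sub_nonneg, div_le_one (Real.sqrt_pos.2 hA)]
  set t := √(piS pi A) with ht
  have ht0 : 0 < t := Real.sqrt_pos.2 hA
  have ht2 : t ^ 2 = piS pi A := Real.sq_sqrt hA.le
  have hX : Integrable (fun u => piS pi (esStep pi p A u)) U :=
    integrable_bdd U (measurable_piS.comp (measurable_esStep_right A)) 1 fun u => h.piS_abs _
  calc ∫ u, √(piS pi (esStep pi p A u)) ∂U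
      ≤ ∫ u, (t / 2 + piS pi (esStep pi p A u) / (2 * t)) ∂U := by
        refine integral_mono (h.integrable_sqrt_step A)
          ((integrable_const _).add (hX.div_const _)) fun u => ?_
        have h1 := Real.sq_sqrt (h.piS_nonneg (esStep pi p A u))
        set w := √(piS pi (esStep pi p A u))
        simp only
        rw [← h1]
        have : t / 2 + w ^ 2 / (2 * t) - w = (t - w) ^ 2 / (2 * t) := by field_simp; ring
        have : 0 ≤ (t - w) ^ 2 / (2 * t) := by positivity
        linarith
    _ = t := by
        rw [integral_add (integrable_const _) (hX.div_const _), integral_const,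
          integral_div (2 * t), h.integral_piS_step, ← ht2]
        simp
        field_simp
        ring

lemma I_empty (h : Hyp pi p) : ∫ u, √(piS pi (esStep pi p ∅ u)) ∂U = 0 := by
  unfold U
  rw [setIntegral_congr_fun (g := fun _ => (0:ℝ)) measurableSet_Ioc]
  · simp
  · intro u hu
    simp [h.esStep_empty hu.1, h.piS_empty]

lemma rt_step_le (h : Hyp pi p) (S : Set V) :
    ∫ u, rt pi (esStep pi p S u) ∂U ≤ ∫ u, √(piS pi (esStep pi p S u)) ∂U := by
  refine integral_mono (integrable_bdd U (measurable_rt.comp (measurable_esStep_right S)) 1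
    fun u => h.rt_abs _) (h.integrable_sqrt_step S) fun u => ?_
  exact Real.sqrt_le_sqrt (min_le_left _ _)

lemma rt_step_le_compl (h : Hyp pi p) (S : Set V) :
    ∫ u, rt pi (esStep pi p S u) ∂U ≤ ∫ u, √(piS pi (esStep pi p Sᶜ u)) ∂U := by
  have h1 : ∫ u, √(piS pi (esStep pi p Sᶜ u)) ∂U = ∫ u, √(piS pi (esStep pi p Sᶜ (1 - u))) ∂U := by
    unfold U
    rw [← intervalIntegral.integral_of_le zero_le_one, ← intervalIntegral.integral_of_le zero_le_one,
      intervalIntegral.integral_comp_sub_left (fun u => √(piS pi (esStep pi p Sᶜ u)))]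
    simp
  rw [h1]
  refine integral_mono (integrable_bdd U (measurable_rt.comp (measurable_esStep_right S)) 1
    fun u => h.rt_abs _) (integrable_bdd U ((measurable_sqrt_step Sᶜ).comp
      (measurable_const.sub measurable_id)) 1 fun u => sqrt_abs_le (h.piS_le_one _)) fun u => ?_
  refine Real.sqrt_le_sqrt ((min_le_right _ _).trans ?_)
  rw [← h.piS_compl]
  refine h.piS_mono fun y hy => ?_
  simp only [esStep, Set.mem_compl_iff, Set.mem_ofPred_eq, not_le] at hy ⊢
  rw [h.QS_compl]
  linarith

lemma exists_sharp (h : Hyp pi p) (S : Set V) : ∃ A : Set V, piS pi A ≤ 1 / 2 ∧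
    piS pi A = min (piS pi S) (1 - piS pi S) ∧
    ∫ u, rt pi (esStep pi p S u) ∂U ≤ ∫ u, √(piS pi (esStep pi p A u)) ∂U := by
  by_cases hS : piS pi S ≤ 1 / 2
  · exact ⟨S, hS, by rw [min_eq_left]; linarith, h.rt_step_le S⟩
  · push Not at hS
    refine ⟨Sᶜ, ?_, ?_, h.rt_step_le_compl S⟩
    · rw [h.piS_compl]; linarith
    · rw [h.piS_compl, min_eq_right]; linarith

lemma rootProfile_nonneg (h : Hyp pi p) (r : ℝ) : 0 ≤ rootProfile pi p r := by
  unfold rootProfile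
  split_ifs <;>
  · refine Real.sInf_nonneg ?_
    rintro _ ⟨S, hS, rfl⟩
    exact h.psi_nonneg hS.1

lemma bdd (h : Hyp pi p) (r : ℝ) :
    BddBelow (psiSet pi p '' {S : Set V | 0 < piS pi S ∧ piS pi S ≤ r}) := by
  refine ⟨0, ?_⟩
  rintro _ ⟨S, hS, rfl⟩
  exact h.psi_nonneg hS.1

lemma rootProfile_le (h : Hyp pi p) {A : Set V} {r : ℝ} (h0 : 0 < piS pi A) (h1 : piS pi A ≤ 1 / 2)
    (hr : piS pi A ≤ r) : rootProfile pi p r ≤ psiSet pi p A := by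
  unfold rootProfile
  split_ifs
  · exact csInf_le (h.bdd r) ⟨A, ⟨h0, hr⟩, rfl⟩
  · exact csInf_le (h.bdd _) ⟨A, ⟨h0, h1⟩, rfl⟩

lemma rootProfile_anti (h : Hyp pi p) (x : V) {r u : ℝ} (hr : 4 * pi x ≤ r) (hru : r ≤ u) :
    rootProfile pi p u ≤ rootProfile pi p r := by
  have hx := h.pos x
  unfold rootProfile
  by_cases h1 : r ≤ 1 / 2
  · have hne : (psiSet pi p '' {S : Set V | 0 < piS pi S ∧ piS pi S ≤ r}).Nonempty :=
      ⟨_, {x}, ⟨by rw [h.piS_singleton]; exact hx, by rw [h.piS_singleton]; linarith⟩, rfl⟩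
    rw [if_pos h1]
    split_ifs
    · exact csInf_le_csInf (h.bdd _) hne (Set.image_mono fun S hS => ⟨hS.1, hS.2.trans hru⟩)
    · exact csInf_le_csInf (h.bdd _) hne (Set.image_mono fun S hS => ⟨hS.1, hS.2.trans h1⟩)
  · rw [if_neg h1, if_neg (by linarith)]

lemma rt_le (h : Hyp pi p) (S : Set V) : ∫ u, rt pi (esStep pi p S u) ∂U ≤ rt pi S := by
  obtain ⟨A, hA, hm, hI⟩ := h.exists_sharp S
  rw [rt, ← hm]
  refine hI.trans ?_
  rcases (h.piS_nonneg A).eq_or_lt with h0 | h0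
  · rw [h.eq_empty_of_piS h0.symm, h.I_empty]; exact Real.sqrt_nonneg _
  · rw [h.I_eq h0]
    have := h.psi_nonneg h0
    have := Real.sqrt_nonneg (piS pi A)
    nlinarith

lemma key (h : Hyp pi p) (S : Set V) {L : ℝ} (hL : 0 < L) :
    ∫ u, rt pi (esStep pi p S u) ∂U ≤
      rt pi S - rootProfile pi p (4 / L ^ 2) * (rt pi S - L / 2 * piS pi S) := by
  have hψ := h.rootProfile_nonneg (4 / L ^ 2)
  by_cases hg : rt pi S ≤ L / 2 * piS pi S
  · have := h.rt_le S
    nlinarith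
  push Not at hg
  obtain ⟨A, hA, hm, hI⟩ := h.exists_sharp S
  have hAS : piS pi A ≤ piS pi S := by rw [hm]; exact min_le_left _ _
  rw [rt, ← hm] at hg ⊢
  have h0 : 0 < piS pi A := by
    have : 0 < √(piS pi A) := lt_of_le_of_lt (by have := h.piS_nonneg S; positivity) hg
    exact Real.sqrt_pos.1 this
  rw [h.I_eq h0] at hI
  have h2 := Real.sq_sqrt h0.le
  have ht := Real.sqrt_pos.2 h0
  set t := √(piS pi A)
  have hr : piS pi A ≤ 4 / L ^ 2 := by
    rw [le_div_iff₀ (by positivity)]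
    have h3 : L / 2 * t < 1 := by
      have : L / 2 * t * t < 1 * t := by nlinarith
      exact lt_of_mul_lt_mul_right this ht.le
    have h4 : 0 < L * t := by positivity
    rw [← h2]; nlinarith
  have h5 := h.rootProfile_le h0 hA hr
  have h6 : 0 ≤ rootProfile pi p (4 / L ^ 2) * (L / 2 * piS pi S) := by
    have := h.piS_nonneg S; positivity
  nlinarith

noncomputable def L (pi : V → ℝ) (p : V → V → ℝ) (x : V) (n : ℕ) : ℝ :=
  (∫ S, rt pi S ∂(law pi p x n)) / pi x

lemma L_anti (h : Hyp pi p) (x : V) (n : ℕ) : L pi p x (n+1) ≤ L pi p x n := by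
  unfold L
  rw [integral_law_succ x n measurable_rt 1 h.rt_abs]
  refine div_le_div_of_nonneg_right ?_ (h.pos x).le
  exact integral_mono (integrable_law_step x n measurable_rt 1 h.rt_abs)
    (integrable_bdd _ measurable_rt 1 h.rt_abs) fun S => h.rt_le S

lemma L_step (h : Hyp pi p) (x : V) (n : ℕ) (hL : 0 < L pi p x n) :
    L pi p x (n+1) ≤ L pi p x n * (1 - rootProfile pi p (4 / L pi p x n ^ 2) / 2) := by
  have hx := h.pos x
  have ha : ∫ S, rt pi S ∂(law pi p x n) = L pi p x n * pi x := by
    unfold L; field_simp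
  set ℓ := L pi p x n
  set ψ := rootProfile pi p (4 / ℓ ^ 2)
  have i1 : Integrable (rt pi) (law pi p x n) := integrable_bdd _ measurable_rt 1 h.rt_abs
  have i2 : Integrable (piS pi) (law pi p x n) := integrable_bdd _ measurable_piS 1 h.piS_abs
  have i3 : Integrable (fun S => rt pi S - ℓ / 2 * piS pi S) (law pi p x n) :=
    i1.sub (i2.const_mul _)
  have i4 : Integrable (fun S => ψ * (rt pi S - ℓ / 2 * piS pi S)) (law pi p x n) := i3.const_mul _
  have : ∫ S, rt pi S ∂(law pi p x (n+1)) ≤ ℓ * pi x - ψ * (ℓ * pi x - ℓ / 2 * pi x) := by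
    rw [integral_law_succ x n measurable_rt 1 h.rt_abs]
    calc _ ≤ ∫ S, (rt pi S - ψ * (rt pi S - ℓ / 2 * piS pi S)) ∂(law pi p x n) :=
          integral_mono (integrable_law_step x n measurable_rt 1 h.rt_abs)
            (i1.sub i4) fun S => h.key S hL
      _ = _ := by
          rw [integral_sub i1 i4, integral_const_mul,
            integral_sub i1 (i2.const_mul _), integral_const_mul, h.integral_piS_law, ha]
  rw [L, div_le_iff₀ hx]
  refine this.trans (le_of_eq ?_)
  ring

lemma L_zero (h : Hyp pi p) (x : V) : L pi p x 0 ^ 2 * (4 * pi x) ≤ 4 := by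
  have hx := h.pos x
  unfold L
  rw [integral_law_zero x measurable_rt, rt, h.piS_singleton]
  have h1 : pi x ≤ 1 := by rw [← h.piS_singleton]; exact h.piS_le_one _
  rw [div_pow, Real.sq_sqrt (le_min hx.le (by linarith))]
  have : min (pi x) (1 - pi x) ≤ pi x := min_le_left _ _
  calc min (pi x) (1 - pi x) / pi x ^ 2 * (4 * pi x) ≤ pi x / pi x ^ 2 * (4 * pi x) := by gcongr
    _ = 4 := by field_simp

lemma cs (h : Hyp pi p) {f g : V → ℝ} {C D : ℝ} (hf : ∀ y, |f y| ≤ C) (hg : ∀ y, |g y| ≤ D) :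
    ∑' y, pi y * (f y * g y) ≤ √(∑' y, pi y * f y ^ 2) * √(∑' y, pi y * g y ^ 2) := by
  have hb : ∀ {f g : V → ℝ} {C D : ℝ} (hf : ∀ y, |f y| ≤ C) (hg : ∀ y, |g y| ≤ D),
      Summable (fun y => pi y * (f y * g y)) := fun {f g C D} hf hg =>
    summable_mul_bdd (C := C * D) h.hpi.summable (fun y => (h.pos y).le) fun y => by
      rw [abs_mul]; exact mul_le_mul (hf y) (hg y) (abs_nonneg _) ((abs_nonneg _).trans (hf y))
  have s1 := (hb hf hf).hasSum
  have s2 := (hb hf hg).hasSum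
  have s3 := (hb hg hg).hasSum
  simp_rw [pow_two]
  set a := ∑' y, pi y * (f y * f y)
  set b := ∑' y, pi y * (f y * g y)
  set c := ∑' y, pi y * (g y * g y)
  have hd : discrim a (2 * b) c ≤ 0 := by
    refine discrim_le_zero fun t => ?_
    have := ((s1.mul_right (t * t)).add (s2.mul_right (2 * t))).add s3
    have h2 : a * (t * t) + 2 * b * t + c = a * (t * t) + b * (2 * t) + c := by ring
    rw [h2]
    refine this.nonneg fun y => ?_
    have : pi y * (f y * f y) * (t * t) + pi y * (f y * g y) * (2 * t) + pi y * (g y * g y)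
      = pi y * (t * f y + g y) ^ 2 := by ring
    rw [this]
    exact mul_nonneg (h.pos y).le (sq_nonneg _)
  have ha : 0 ≤ a := s1.nonneg fun y => mul_nonneg (h.pos y).le (mul_self_nonneg _)
  rw [← Real.sqrt_mul ha]
  refine Real.le_sqrt_of_sq_le ?_
  unfold discrim at hd
  nlinarith

lemma chi_le (h : Hyp pi p) (x : V) (n : ℕ) : chiSq pi (pn p n x) ≤ L pi p x n ^ 2 := by
  have hx := h.pos x
  set ν := law pi p x n
  set g : V → ℝ := fun y => pn p n x y / pi y - 1 with hgdef
  have hiy : ∀ y, Integrable (ind y) ν := fun y => integrable_bdd _ (measurable_ind y) 1 (ind_abs y)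
  have hip : Integrable (piS pi) ν := integrable_bdd _ measurable_piS 1 h.piS_abs
  have hg : ∀ y, ∫ S, (ind y S - piS pi S) / pi x ∂ν = g y := by
    intro y
    rw [integral_div, integral_sub (hiy y) hip, h.integral_piS_law, h.integral_ind_law, hgdef]
    have := (h.pos y).ne'
    field_simp
  have hd : ∀ y S, |ind y S - piS pi S| ≤ 1 := fun y S => by
    rw [abs_le]; constructor <;>
      linarith [ind_nonneg y S, ind_le_one y S, h.piS_nonneg S, h.piS_le_one S]
  have hd' : ∀ y S, |(ind y S - piS pi S) / pi x| ≤ 1 / pi x := fun y S => by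
    rw [abs_div, abs_of_pos hx]; exact div_le_div_of_nonneg_right (hd y S) hx.le
  have hgb : ∀ y, |g y| ≤ 1 / pi x := fun y => by
    rw [← hg, ← Real.norm_eq_abs]
    refine (norm_integral_le_of_norm_le_const (C := 1 / pi x)
      (Filter.Eventually.of_forall fun S => hd' y S)).trans ?_
    simp
  have hvar : ∀ S, √(∑' y, pi y * (ind y S - piS pi S) ^ 2) ≤ rt pi S := by
    intro S
    refine Real.sqrt_le_sqrt ?_
    have h1 : HasSum (fun y => pi y * (ind y S - piS pi S) ^ 2)
        (piS pi S * (1 - 2 * piS pi S) + 1 * piS pi S ^ 2) := by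
      have := ((h.piS_hasSum S).mul_right (1 - 2 * piS pi S)).add (h.hpi.mul_right (piS pi S ^ 2))
      refine this.congr_fun ?_
      intro y
      have := ind_sq y S
      linear_combination (pi y) * this
    rw [h1.tsum_eq]
    have := h.piS_nonneg S
    have := h.piS_le_one S
    refine le_min ?_ ?_ <;> nlinarith
  set X := chiSq pi (pn p n x) with hX
  have hXeq : X = ∑' y, pi y * g y ^ 2 := rfl
  have hX0 : 0 ≤ X := tsum_nonneg fun y => mul_nonneg (h.pos y).le (sq_nonneg _)
  have hsw := integral_swap ν h.hpi.summable (fun y => (h.pos y).le)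
    (F := fun y S => g y * ((ind y S - piS pi S) / pi x)) (C := 1 / pi x * (1 / pi x))
    (fun y => (((measurable_ind y).sub measurable_piS).div_const _).const_mul _)
    (fun y S => by
      rw [abs_mul]; exact mul_le_mul (hgb y) (hd' y S) (abs_nonneg _) (by positivity))
  have hX1 : X = ∫ S, ∑' y, pi y * (g y * ((ind y S - piS pi S) / pi x)) ∂ν := by
    rw [← hsw.tsum_eq, hXeq]
    congr 1; ext y
    rw [integral_const_mul, hg, pow_two]
  have hX2 : X ≤ √X * L pi p x n := by
    have hirt : Integrable (rt pi) ν := integrable_bdd _ measurable_rt 1 h.rt_abs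
    have hpt : ∀ S, ∑' y, pi y * (g y * ((ind y S - piS pi S) / pi x)) ≤ √X * (rt pi S / pi x) := by
      intro S
      have h1 := h.cs hgb (fun y => hd y S)
      rw [← hXeq] at h1
      have h2 := h1.trans (mul_le_mul_of_nonneg_left (hvar S) (Real.sqrt_nonneg X))
      have h3 : ∑' y, pi y * (g y * ((ind y S - piS pi S) / pi x))
          = (∑' y, pi y * (g y * (ind y S - piS pi S))) / pi x := by
        rw [← tsum_div_const]; congr 1; ext y; ring
      rw [h3, mul_div_assoc']
      exact div_le_div_of_nonneg_right h2 hx.le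
    by_cases hi1 : Integrable (fun S => ∑' y, pi y * (g y * ((ind y S - piS pi S) / pi x))) ν
    swap
    · have h0 : X = 0 := by rw [hX1, integral_undef hi1]
      rw [h0]; simp
    have hle : X ≤ ∫ S, √X * (rt pi S / pi x) ∂ν := by
      calc X = _ := hX1
        _ ≤ _ := integral_mono hi1 ((hirt.div_const _).const_mul _) hpt
    rw [integral_const_mul, integral_div] at hle
    exact hle
  have h1 := Real.sq_sqrt hX0
  have h0 := Real.sqrt_nonneg X
  have hL0 : 0 ≤ L pi p x n := div_nonneg (integral_nonneg fun S => rt_nonneg S) hx.le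
  rcases h0.eq_or_lt with h2 | h2
  · rw [← h1, ← h2]; nlinarith
  · have : √X ≤ L pi p x n := le_of_mul_le_mul_left (by nlinarith) h2
    rw [← h1]
    exact pow_le_pow_left₀ h0 this 2

end Hyp

lemma final {ψ : ℝ → ℝ} {L : ℕ → ℝ} {a ε : ℝ} (ha : 0 < a) (hε : 0 < ε) (hψ0 : ∀ r, 0 ≤ ψ r)
    (hanti : ∀ r u, a ≤ r → r ≤ u → ψ u ≤ ψ r) (h0 : L 0 ^ 2 * a ≤ 4)
    (hstep : ∀ k, 0 < L k → L (k+1) ≤ L k * (1 - ψ (4 / L k ^ 2) / 2))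
    (n : ℕ) (hpos : ∀ k ≤ n, 0 < L k) (hbig : ∀ k ≤ n, ε < L k ^ 2) :
    (n : ℝ≥0∞) < ∫⁻ u in Ioc a (4 / ε), 1 / ENNReal.ofReal (u * ψ u) := by
  set G : ℝ → ℝ≥0∞ := fun u => 1 / ENNReal.ofReal (u * ψ u) with hG
  set E := 4 / ε
  set r : ℕ → ℝ := fun k => 4 / L k ^ 2 with hr
  have hrE : ∀ k ≤ n, r k < E := fun k hk => div_lt_div_of_pos_left (by norm_num) hε (hbig k hk)
  have hr1 : ∀ k, k + 1 ≤ n → r k * Real.exp (ψ (r k)) ≤ r (k+1) := by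
    intro k hk
    have p1 := hpos k (by omega)
    have p2 := hpos (k+1) hk
    have h1 := hstep k p1
    have h2 : 1 - ψ (r k) / 2 ≤ Real.exp (-(ψ (r k) / 2)) := by
      have := Real.add_one_le_exp (-(ψ (r k) / 2)); linarith
    have h3 : L (k+1) ≤ L k * Real.exp (-(ψ (r k) / 2)) :=
      h1.trans (mul_le_mul_of_nonneg_left h2 p1.le)
    have h4 : L (k+1) ^ 2 ≤ L k ^ 2 * Real.exp (-(ψ (r k))) := by
      calc L (k+1) ^ 2 ≤ (L k * Real.exp (-(ψ (r k) / 2))) ^ 2 := pow_le_pow_left₀ p2.le h3 2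
        _ = _ := by rw [mul_pow, ← Real.exp_nat_mul]; congr 2; push_cast; ring
    have h5 : L (k+1) ^ 2 * Real.exp (ψ (r k)) ≤ L k ^ 2 := by
      calc _ ≤ L k ^ 2 * Real.exp (-(ψ (r k))) * Real.exp (ψ (r k)) := by gcongr
        _ = _ := by rw [mul_assoc, ← Real.exp_add]; simp
    show 4 / L k ^ 2 * Real.exp (ψ (r k)) ≤ 4 / L (k+1) ^ 2
    rw [le_div_iff₀ (by positivity), div_mul_eq_mul_div, div_mul_eq_mul_div, div_le_iff₀ (by positivity)]
    linarith
  have hrpos : ∀ k ≤ n, 0 < r k := fun k hk => by have := hpos k hk; positivity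
  have hra : ∀ k ≤ n, a ≤ r k := by
    intro k
    induction k with
    | zero => intro _; have := hpos 0 (Nat.zero_le _); rw [hr]; simp only; rw [le_div_iff₀ (by positivity)]; linarith
    | succ k ih =>
      intro hk
      have h1 := ih (by omega)
      have h2 := Real.one_le_exp (hψ0 (r k))
      have := hr1 k hk
      nlinarith [hrpos k (by omega)]
  have hfin : ∀ u, 0 < G u := fun u => by simp [hG]
  have hmain : ∀ k, k + 1 ≤ n → 1 + ∫⁻ u in Ioc (r (k+1)) E, G u ≤ ∫⁻ u in Ioc (r k) E, G u := by
    intro k hk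
    have hrk := hrpos k (by omega)
    have hlow : ∀ u ∈ Ioc (r k) E, 1 / ENNReal.ofReal (u * ψ (r k)) ≤ G u := by
      intro u hu
      refine ENNReal.div_le_div_left (ENNReal.ofReal_le_ofReal ?_) _
      exact mul_le_mul_of_nonneg_left (hanti _ _ (hra k (by omega)) hu.1.le) (hrk.trans hu.1).le
    rcases (hψ0 (r k)).eq_or_lt with hz | hz
    · have : ∫⁻ u in Ioc (r k) E, G u = ⊤ := by
        rw [eq_top_iff]
        calc (⊤ : ℝ≥0∞) = ∫⁻ u in Ioc (r k) E, ⊤ := by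
              simp [hrE k (by omega)]
          _ ≤ _ := by
              refine setLIntegral_mono' measurableSet_Ioc fun u hu => ?_
              have := hlow u hu
              rw [← hz] at this
              simpa using this
      rw [this]; exact le_top
    · have hrr : r k ≤ r (k+1) := by
        have := Real.one_le_exp (hψ0 (r k)); have := hr1 k hk; nlinarith
      have hE := (hrE (k+1) hk).le
      rw [← Ioc_union_Ioc_eq_Ioc hrr hE, lintegral_union measurableSet_Ioc (Ioc_disjoint_Ioc_of_le le_rfl)]
      gcongr
      have hr' := hrpos (k+1) hk
      have hint : IntegrableOn (fun u : ℝ => 1 / u * (1 / ψ (r k))) (Ioc (r k) (r (k+1))) := by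
        rw [← intervalIntegrable_iff_integrableOn_Ioc_of_le hrr]
        refine ContinuousOn.intervalIntegrable ?_
        rw [uIcc_of_le hrr]
        refine ContinuousOn.mul (continuousOn_const.div continuousOn_id fun u hu => ?_) continuousOn_const
        exact (hrk.trans_le hu.1).ne'
      calc (1 : ℝ≥0∞) ≤ ENNReal.ofReal (∫ u in Ioc (r k) (r (k+1)), 1 / u * (1 / ψ (r k))) := by
            rw [integral_mul_const, ← intervalIntegral.integral_of_le hrr,
              integral_one_div_of_pos hrk hr', ← ENNReal.ofReal_one]
            refine ENNReal.ofReal_le_ofReal ?_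
            rw [mul_one_div, le_div_iff₀ hz, one_mul, Real.le_log_iff_exp_le (by positivity),
              le_div_iff₀ hrk]
            linarith [hr1 k hk]
        _ = ∫⁻ u in Ioc (r k) (r (k+1)), ENNReal.ofReal (1 / u * (1 / ψ (r k))) := by
            refine ofReal_integral_eq_lintegral_ofReal hint ?_
            refine (ae_restrict_iff' measurableSet_Ioc).2 (Filter.Eventually.of_forall fun u hu => ?_)
            have : 0 < u := hrk.trans hu.1
            simp only [Pi.zero_apply]; positivity
        _ ≤ ∫⁻ u in Ioc (r k) (r (k+1)), G u := by
            refine setLIntegral_mono' measurableSet_Ioc fun u hu => ?_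
            have hu0 : 0 < u := hrk.trans hu.1
            refine le_trans (le_of_eq ?_) (hlow u ⟨hu.1, hu.2.trans hE⟩)
            rw [one_div_mul_one_div, ENNReal.ofReal_div_of_pos (by positivity), ENNReal.ofReal_one]
  have hind : ∀ k ≤ n, (k : ℝ≥0∞) + ∫⁻ u in Ioc (r k) E, G u ≤ ∫⁻ u in Ioc a E, G u := by
    intro k
    induction k with
    | zero =>
      intro hk
      simp only [Nat.cast_zero, zero_add]
      exact lintegral_mono_set (Ioc_subset_Ioc_left (hra 0 hk))
    | succ k ih =>
      intro hk
      refine le_trans ?_ (ih (by omega))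
      push_cast
      rw [add_assoc]
      gcongr
      exact hmain k hk
  refine lt_of_lt_of_le ?_ (hind n le_rfl)
  have hp : 0 < ∫⁻ u in Ioc (r n) E, G u := by
    have hrn := hrE n le_rfl
    have hr0 := hrpos n le_rfl
    calc (0 : ℝ≥0∞) < 1 / ENNReal.ofReal (E * ψ (r n)) * volume (Ioc (r n) E) := by
          refine ENNReal.mul_pos (by simp) ?_
          simp [hrn]
      _ = ∫⁻ u in Ioc (r n) E, 1 / ENNReal.ofReal (E * ψ (r n)) := by
          rw [setLIntegral_const]
      _ ≤ _ := by
          refine setLIntegral_mono' measurableSet_Ioc fun u hu => ?_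
          refine ENNReal.div_le_div_left (ENNReal.ofReal_le_ofReal ?_) _
          exact mul_le_mul hu.2 (hanti _ _ (hra n le_rfl) hu.1.le) (hψ0 _) (hr0.trans hrn).le
  exact ENNReal.lt_add_right (ENNReal.natCast_ne_top n) hp.ne'

/-- Theorem (psith): `χ²(μ_n, π) ≤ ε` once `n` exceeds the root-profile integral. -/
theorem chiSq_le_of_rootProfile_integral [Countable V]
    (p : V → V → ℝ) (pi : V → ℝ)
    (hp0 : ∀ x y, 0 ≤ p x y) (hp1 : ∀ x, ∑' y, p x y = 1)
    (hpipos : ∀ x, 0 < pi x) (hpi1 : ∑' x, pi x = 1)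
    (hstat : ∀ y, ∑' x, pi x * p x y = pi y)
    (hirr : ∀ x y : V, ∃ n, 0 < pn p n x y)
    (x : V) (ε : ℝ) (hε : 0 < ε) :
    ∀ n : ℕ,
      (∫⁻ u in Ioc (4 * pi x) (4 / ε),
          1 / ENNReal.ofReal (u * rootProfile pi p u)) ≤ (n : ℝ≥0∞) →
      chiSq pi (pn p n x) ≤ ε := by
  have hsum : ∀ {f : V → ℝ} {a : ℝ}, a ≠ 0 → ∑' y, f y = a → HasSum f a := by
    intro f a ha hf
    have : Summable f := by
      by_contra hn
      rw [tsum_eq_zero_of_not_summable hn] at hf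
      exact ha hf.symm
    rw [← hf]; exact this.hasSum
  have h : Hyp pi p := ⟨hp0, fun x => hsum one_ne_zero (hp1 x), hpipos, hsum one_ne_zero hpi1,
    fun y => hsum (hpipos y).ne' (hstat y)⟩
  intro n hn
  by_contra hlt
  push Not at hlt
  have hx := hpipos x
  have hanti : Antitone (Hyp.L pi p x) := antitone_nat_of_succ_le (h.L_anti x)
  have hnn : ∀ k, 0 ≤ Hyp.L pi p x k := fun k =>
    div_nonneg (integral_nonneg fun S => Hyp.rt_nonneg S) hx.le
  have hbig : ∀ k ≤ n, ε < Hyp.L pi p x k ^ 2 := fun k hk =>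
    (hlt.trans_le (h.chi_le x n)).trans_le (pow_le_pow_left₀ (hnn n) (hanti hk) 2)
  have hpos : ∀ k ≤ n, 0 < Hyp.L pi p x k := fun k hk => by
    refine (hnn k).lt_of_ne fun he => ?_
    have := hbig k hk
    rw [← he] at this
    norm_num at this; linarith
  exact absurd hn (not_le.2 (final (by positivity) hε h.rootProfile_nonneg
    (fun r u h1 h2 => h.rootProfile_anti x h1 h2) (h.L_zero x) (h.L_step x) n hpos hbig))

end EvolvingSetsPaper
end

section
/- Let ∅ ≠ S ⊆ V. If 0 < γ ≤ 1/2 and p(x,x) ≥ γ for all x ∈ V, then ψ(S) ≥ (γ²/(2(1−γ)²)) Φ_S². In particular, if p(x,x) ≥ 1/2 for all x ∈ V, then ψ(S) ≥ Φ_S²/2. -/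
open MeasureTheory Set
open scoped ENNReal Classical

namespace EvolvingSetsPaper

variable {V : Type*}

theorem le_of_sq_le_sq_aux {a b : ℝ} (h : a ^ 2 ≤ b ^ 2) (hb : 0 ≤ b) : a ≤ b :=
  le_of_abs_le (abs_le_of_sq_le_sq h hb)

theorem aux_cs (f : ℝ → ℝ) (a b : ℝ) (hab : a < b) (hf0 : ∀ u, 0 ≤ f u)
    (hf : IntervalIntegrable f volume a b)
    (hg : IntervalIntegrable (fun u => Real.sqrt (f u)) volume a b) :
    (∫ u in a..b, Real.sqrt (f u)) ^ 2 ≤ (b - a) * ∫ u in a..b, f u := by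
  set I := ∫ u in a..b, Real.sqrt (f u) with hI
  set F := ∫ u in a..b, f u with hF
  have key : ∀ t : ℝ, 2 * t * I ≤ F + t ^ 2 * (b - a) := by
    intro t
    have h1 : ∫ u in a..b, (2 * t) * Real.sqrt (f u) ≤ ∫ u in a..b, (f u + t ^ 2) := by
      apply intervalIntegral.integral_mono_on hab.le (hg.const_mul _)
        (hf.add intervalIntegrable_const)
      intro u _
      have := Real.sq_sqrt (hf0 u)
      nlinarith [sq_nonneg (Real.sqrt (f u) - t)]
    rw [intervalIntegral.integral_const_mul,
      intervalIntegral.integral_add hf intervalIntegrable_const,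
      intervalIntegral.integral_const, smul_eq_mul] at h1
    linarith [h1]
  have hc : 0 < b - a := sub_pos.2 hab
  have h := key (I / (b - a))
  have e1 : 2 * (I / (b - a)) * I = 2 * I ^ 2 / (b - a) := by ring
  have e2 : (I / (b - a)) ^ 2 * (b - a) = I ^ 2 / (b - a) := by field_simp
  rw [e1, e2] at h
  have h2 : I ^ 2 / (b - a) ≤ F := by
    have : 2 * I ^ 2 / (b - a) = I ^ 2 / (b - a) + I ^ 2 / (b - a) := by ring
    linarith
  rw [div_le_iff₀ hc] at h2
  linarith

theorem aux_alg (g P I1 I2 F1 F2 : ℝ) (hg : 0 < g) (hg1 : g < 1) (hP : 0 ≤ P)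
    (h1 : I1 ^ 2 ≤ g * F1) (h2 : I2 ^ 2 ≤ (1 - g) * F2) (hF : F1 + F2 = 1)
    (hF1 : g + g / (1 - g) * P ≤ F1) (hF2 : 0 ≤ F2) :
    g ^ 2 / (2 * (1 - g) ^ 2) * P ^ 2 ≤ 1 - (I1 + I2) := by
  have hg' : 0 < 1 - g := by linarith
  have hF10 : 0 ≤ F1 := by
    have : 0 ≤ g / (1 - g) * P := by positivity
    linarith
  set A := Real.sqrt (F1 / g) with hA
  set B := Real.sqrt (F2 / (1 - g)) with hB
  have hA0 : 0 ≤ A := Real.sqrt_nonneg _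
  have hB0 : 0 ≤ B := Real.sqrt_nonneg _
  have hA2 : g * A ^ 2 = F1 := by
    rw [hA, Real.sq_sqrt (by positivity)]; field_simp
  have hB2 : (1 - g) * B ^ 2 = F2 := by
    rw [hB, Real.sq_sqrt (by positivity)]; field_simp
  have hI1 : I1 ≤ g * A := by
    apply le_of_sq_le_sq_aux _ (by positivity)
    calc I1 ^ 2 ≤ g * F1 := h1
      _ = (g * A) ^ 2 := by rw [← hA2]; ring
  have hI2 : I2 ≤ (1 - g) * B := by
    apply le_of_sq_le_sq_aux _ (by positivity)
    calc I2 ^ 2 ≤ (1 - g) * F2 := h2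
      _ = ((1 - g) * B) ^ 2 := by rw [← hB2]; ring
  have hs : g * A ^ 2 + (1 - g) * B ^ 2 = 1 := by linarith
  set M := g * A + (1 - g) * B with hM
  have hM1 : 1 - M ^ 2 = g * (1 - g) * (A - B) ^ 2 := by
    have : 1 - M ^ 2 = (g * A ^ 2 + (1 - g) * B ^ 2) - M ^ 2 := by rw [hs]
    rw [this, hM]; ring
  have hM2 : (1 - M ^ 2) / 2 ≤ 1 - M := by nlinarith [sq_nonneg (1 - M)]
  have hcs : g * (1 - g) * (A + B) ^ 2 ≤ 1 := by
    have : 1 - g * (1 - g) * (A + B) ^ 2 = (g * A - (1 - g) * B) ^ 2 := by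
      have : 1 - g * (1 - g) * (A + B) ^ 2
        = (g * A ^ 2 + (1 - g) * B ^ 2) - g * (1 - g) * (A + B) ^ 2 := by rw [hs]
      rw [this]; ring
    nlinarith [sq_nonneg (g * A - (1 - g) * B)]
  have hd : F1 - g = g * (1 - g) * (A ^ 2 - B ^ 2) := by
    have : F1 - g = g * A ^ 2 - g * (g * A ^ 2 + (1 - g) * B ^ 2) := by rw [hs, hA2]; ring
    rw [this]; ring
  have hx : (F1 - g) ^ 2 ≤ 1 - M ^ 2 := by
    rw [hM1, hd]
    have h0 : 0 ≤ g * (1 - g) * (A - B) ^ 2 := by positivity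
    calc (g * (1 - g) * (A ^ 2 - B ^ 2)) ^ 2
        = (g * (1 - g) * (A - B) ^ 2) * (g * (1 - g) * (A + B) ^ 2) := by ring
      _ ≤ (g * (1 - g) * (A - B) ^ 2) * 1 := mul_le_mul_of_nonneg_left hcs h0
      _ = _ := by ring
  have hy : (g / (1 - g) * P) ^ 2 ≤ (F1 - g) ^ 2 := by
    apply pow_le_pow_left₀ (by positivity); linarith
  have hz : g ^ 2 / (2 * (1 - g) ^ 2) * P ^ 2 = (g / (1 - g) * P) ^ 2 / 2 := by
    field_simp
  rw [hz]; linarith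

theorem aux_int (pi q : V → ℝ) [Countable V] (hpi : ∀ y, 0 < pi y) (hs : Summable pi)
    (hq : ∀ y, 0 ≤ q y) (c : ℝ) (hc : 0 ≤ c) :
    HasSum (fun y => min (q y) (c * pi y))
      (∫ u in (0:ℝ)..c, piS pi {y | u * pi y ≤ q y}) := by
  have hind : ∀ (y : V) (u : ℝ), ({y | u * pi y ≤ q y} : Set V).indicator pi y
      = (Iic (q y / pi y)).indicator (fun _ => pi y) u := by
    intro y u
    simp only [indicator, mem_ofPred_eq, mem_Iic, le_div_iff₀ (hpi y)]
  have hint : ∀ y, ∫ u in Ioc 0 c, (Iic (q y / pi y)).indicator (fun _ => pi y) u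
      = min (q y) (c * pi y) := by
    intro y
    rw [setIntegral_indicator measurableSet_Iic, Ioc_inter_Iic, setIntegral_const]
    have h0 : 0 ≤ min c (q y / pi y) := le_min hc (div_nonneg (hq y) (hpi y).le)
    rw [Real.volume_real_Ioc_of_le (by simpa using h0), smul_eq_mul, sub_zero,
      min_mul_of_nonneg _ _ (hpi y).le, div_mul_cancel₀ _ (hpi y).ne', min_comm]
  have hsm : Summable fun y => min (q y) (c * pi y) :=
    Summable.of_nonneg_of_le (fun y => le_min (hq y) (mul_nonneg hc (hpi y).le))
      (fun y => min_le_right _ _) (hs.mul_left c)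
  have H := hasSum_integral_of_summable_integral_norm (μ := volume.restrict (Ioc 0 c))
    (F := fun y u => (Iic (q y / pi y)).indicator (fun _ => pi y) u)
    (fun y => (integrable_const _).indicator measurableSet_Iic) (by
      convert hsm using 2 with y
      rw [← hint y]
      congr 1
      ext u
      rw [Real.norm_of_nonneg]
      exact indicator_nonneg (fun _ _ => (hpi y).le) _)
  rw [intervalIntegral.integral_of_le hc]
  simp only [hint] at H
  have heq : (fun u : ℝ => piS pi {y | u * pi y ≤ q y})
      = fun u => ∑' y, (Iic (q y / pi y)).indicator (fun _ => pi y) u := by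
    funext u
    rw [piS, tsum_subtype]
    exact tsum_congr fun y => hind y u
  rw [heq]
  exact H

set_option maxHeartbeats 1000000 in
theorem aux_main [Countable V]
    (p : V → V → ℝ) (pi : V → ℝ)
    (hp0 : ∀ x y, 0 ≤ p x y) (hp1 : ∀ x, ∑' y, p x y = 1)
    (hpipos : ∀ x, 0 < pi x) (hpi1 : ∑' x, pi x = 1)
    (hstat : ∀ y, ∑' x, pi x * p x y = pi y)
    (S : Set V) (hS : S.Nonempty) (g : ℝ) (hg : 0 < g) (hg2 : g ≤ 1 / 2)
    (hgp : ∀ x, g ≤ p x x) :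
    g ^ 2 / (2 * (1 - g) ^ 2) * cond pi p S ^ 2 ≤ psiSet pi p S := by
  have hg' : 0 < 1 - g := by linarith
  have hspi : Summable pi := by
    by_contra h; rw [tsum_eq_zero_of_not_summable h] at hpi1; norm_num at hpi1
  have hsp : ∀ x, Summable (p x) := by
    intro x; by_contra h
    have := hp1 x; rw [tsum_eq_zero_of_not_summable h] at this; norm_num at this
  have hsq : ∀ y, Summable fun x => pi x * p x y := by
    intro y; by_contra h
    have := hstat y; rw [tsum_eq_zero_of_not_summable h] at this
    exact (hpipos y).ne this
  have hnn : ∀ x y, 0 ≤ pi x * p x y := fun x y => mul_nonneg (hpipos x).le (hp0 x y)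
  have hQ0 : ∀ y, 0 ≤ QS pi p S y := fun y => tsum_nonneg fun s => hnn _ _
  have hmonoQ : ∀ (A B : Set V) (y : V), A ⊆ B → QS pi p A y ≤ QS pi p B y := by
    intro A B y h
    rw [QS, QS, tsum_subtype A (fun x => pi x * p x y), tsum_subtype B (fun x => pi x * p x y)]
    exact Summable.tsum_le_tsum
      (fun x => indicator_le_indicator_of_subset h (fun x => hnn x y) x)
      ((hsq y).indicator _) ((hsq y).indicator _)
  have hQuniv : ∀ y, QS pi p univ y = pi y := by
    intro y; rw [QS, tsum_univ (fun x => pi x * p x y), hstat]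
  have hQsing : ∀ y, QS pi p {y} y = pi y * p y y := by
    intro y; rw [QS, tsum_singleton y (fun x => pi x * p x y)]
  have hQle : ∀ y, QS pi p S y ≤ pi y := fun y => by
    rw [← hQuniv y]; exact hmonoQ _ _ _ (subset_univ _)
  have hQin : ∀ y ∈ S, g * pi y ≤ QS pi p S y := by
    intro y hy
    have h1 := hmonoQ {y} S y (by simpa using hy)
    rw [hQsing] at h1
    nlinarith [hgp y, hpipos y]
  have hQout : ∀ y ∉ S, QS pi p S y ≤ (1 - g) * pi y := by
    intro y hy
    have h1 := hmonoQ S {y}ᶜ y (by simpa using hy)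
    have h2 : QS pi p {y} y + QS pi p {y}ᶜ y = pi y := by
      rw [← hstat y]
      exact (hsq y).tsum_subtype_add_tsum_subtype_compl {y}
    rw [hQsing] at h2
    nlinarith [hgp y, hpipos y]
  have hpiS0 : 0 < piS pi S := by
    obtain ⟨x, hx⟩ := hS
    exact (hspi.subtype S).tsum_pos (fun y => (hpipos _).le) ⟨x, hx⟩ (hpipos x)
  have hsQ : Summable (QS pi p S) := Summable.of_nonneg_of_le hQ0 hQle hspi
  -- total
  have htot : ∑' y, QS pi p S y = piS pi S := by
    have hprod : Summable (Function.uncurry fun (s : S) (y : V) => pi s * p s y) := by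
      refine (summable_prod_of_nonneg (f := Function.uncurry fun (s : S) (y : V) => pi s * p s y) (fun z => hnn z.1 z.2)).2 ?_
      refine ⟨fun s => (hsp (s : V)).mul_left (pi (s : V)), ?_⟩
      simp only [Function.uncurry, tsum_mul_left, hp1, mul_one]
      exact hspi.subtype S
    have := hprod.tsum_comm
    simp only [QS, piS]
    rw [this]
    simp only [tsum_mul_left, hp1, mul_one]
  set f : ℝ → ℝ := fun u => piS pi (esStep pi p S u) / piS pi S with hf
  have hanti0 : Antitone fun u => piS pi (esStep pi p S u) := by
    intro u v huv
    simp only [piS]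
    rw [tsum_subtype _ pi, tsum_subtype _ pi]
    refine Summable.tsum_le_tsum
      (fun x => indicator_le_indicator_of_subset ?_ (fun x => (hpipos x).le) x)
      (hspi.indicator _) (hspi.indicator _)
    intro y hy
    exact le_trans (mul_le_mul_of_nonneg_right huv (hpipos y).le) hy
  have hanti : Antitone f := fun u v huv =>
    div_le_div_of_nonneg_right (hanti0 huv) hpiS0.le
  have hantis : Antitone fun u => Real.sqrt (f u) := fun u v huv =>
    Real.sqrt_le_sqrt (hanti huv)
  have hf0 : ∀ u, 0 ≤ f u := fun u =>
    div_nonneg (tsum_nonneg fun y => (hpipos _).le) hpiS0.le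
  have hfi : ∀ a b, IntervalIntegrable f volume a b := fun a b => hanti.intervalIntegrable
  have hsi : ∀ a b, IntervalIntegrable (fun u => Real.sqrt (f u)) volume a b :=
    fun a b => hantis.intervalIntegrable
  have hsum : ∀ c, 0 ≤ c → HasSum (fun y => min (QS pi p S y) (c * pi y))
      (∫ u in (0:ℝ)..c, piS pi (esStep pi p S u)) := fun c hc =>
    aux_int pi (QS pi p S) hpipos hspi hQ0 c hc
  have hfint : ∀ a b, ∫ u in a..b, f u
      = (∫ u in a..b, piS pi (esStep pi p S u)) / piS pi S := fun a b =>
    intervalIntegral.integral_div _ _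
  have hF : ∫ u in (0:ℝ)..1, f u = 1 := by
    rw [hfint, ← (hsum 1 zero_le_one).tsum_eq]
    simp only [one_mul, min_eq_left (hQle _), htot]
    exact div_self hpiS0.ne'
  have hF1 : g + g / (1 - g) * cond pi p S ≤ ∫ u in (0:ℝ)..g, f u := by
    have e : g + g / (1 - g) * cond pi p S
        = (g * piS pi S + g / (1 - g) * Qset pi p S Sᶜ) / piS pi S := by
      rw [cond]; field_simp
    rw [hfint, e]
    apply div_le_div_of_nonneg_right _ hpiS0.le
    have hm := hsum g hg.le
    rw [← hm.tsum_eq, ← hm.summable.tsum_subtype_add_tsum_subtype_compl S]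
    simp only [piS, Qset]
    rw [← tsum_mul_left, ← tsum_mul_left]
    apply add_le_add
    · exact Summable.tsum_le_tsum (fun y => le_min (hQin y y.2) le_rfl)
        ((hspi.mul_left g).subtype S) (hm.summable.subtype S)
    · refine Summable.tsum_le_tsum (fun y => ?_)
        ((hsQ.mul_left (g / (1 - g))).subtype Sᶜ) (hm.summable.subtype Sᶜ)
      have h1 := hQout y y.2
      apply le_min
      · have : g / (1 - g) ≤ 1 := by rw [div_le_one hg']; linarith
        exact mul_le_of_le_one_left (hQ0 _) this
      · calc g / (1 - g) * QS pi p S y ≤ g / (1 - g) * ((1 - g) * pi y) :=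
              mul_le_mul_of_nonneg_left h1 (by positivity)
          _ = g * pi y := by field_simp
  have hadd := intervalIntegral.integral_add_adjacent_intervals (hfi 0 g) (hfi g 1)
  have hadds := intervalIntegral.integral_add_adjacent_intervals (hsi 0 g) (hsi g 1)
  have c1 := aux_cs f 0 g hg hf0 (hfi _ _) (hsi _ _)
  have c2 := aux_cs f g 1 (by linarith) hf0 (hfi _ _) (hsi _ _)
  rw [sub_zero] at c1
  have hP : 0 ≤ cond pi p S := div_nonneg (tsum_nonneg fun y => hQ0 _) hpiS0.le
  have := aux_alg g (cond pi p S) _ _ _ _ hg (by linarith) hP c1 c2 (hadd.trans hF) hF1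
    (intervalIntegral.integral_nonneg (by linarith) fun u _ => hf0 u)
  rw [hadds] at this
  exact this

/-- Lemma (ll): `ψ(S) ≥ (γ²/(2(1-γ)²)) Φ_S²`; in particular, under the laziness
assumption `p(x,x) ≥ 1/2`, `ψ(S) ≥ Φ_S²/2`. -/
theorem psiSet_ge_cond_sq [Countable V]
    (p : V → V → ℝ) (pi : V → ℝ)
    (hp0 : ∀ x y, 0 ≤ p x y) (hp1 : ∀ x, ∑' y, p x y = 1)
    (hpipos : ∀ x, 0 < pi x) (hpi1 : ∑' x, pi x = 1)
    (hstat : ∀ y, ∑' x, pi x * p x y = pi y)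
    (hirr : ∀ x y : V, ∃ n, 0 < pn p n x y)
    (S : Set V) (hS : S.Nonempty) :
    (∀ γ : ℝ, 0 < γ → γ ≤ 1 / 2 → (∀ x, γ ≤ p x x) →
        γ ^ 2 / (2 * (1 - γ) ^ 2) * cond pi p S ^ 2 ≤ psiSet pi p S) ∧
      ((∀ x, (1 : ℝ) / 2 ≤ p x x) → cond pi p S ^ 2 / 2 ≤ psiSet pi p S) := by
  refine ⟨fun g h1 h2 h3 => aux_main p pi hp0 hp1 hpipos hpi1 hstat S hS g h1 h2 h3, fun h => ?_⟩
  have := aux_main p pi hp0 hp1 hpipos hpi1 hstat S hS (1 / 2) (by norm_num) le_rfl h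
  norm_num at this
  linarith

end EvolvingSetsPaper
end

section
/- For all n ≥ 0 and all x, y ∈ V, p^n(x,y) = (π(y)/π(x)) · P_{{x}}(y ∈ S_n), where (S_n) is the evolving set process started from S_0 = {x}. -/
open MeasureTheory Set
open scoped ENNReal Classical

namespace EvolvingSetsPaper

variable {V : Type*}

lemma aux_summable {f : V → ℝ} {k : V → V → ℝ} {b : V → ℝ} (hf0 : ∀ x, 0 ≤ f x)
    (hf : Summable f) (hk0 : ∀ x y, 0 ≤ k x y) (hk : ∀ x, HasSum (k x) 1)
    (hb0 : ∀ x, 0 ≤ b x) (hb1 : ∀ x, b x ≤ 1) :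
    Summable (fun q : V × V => f q.1 * k q.1 q.2 * b q.2) := by
  have h1 : Summable (fun q : V × V => f q.1 * k q.1 q.2) := by
    have h0 : 0 ≤ (fun q : V × V => f q.1 * k q.1 q.2) :=
      fun q => mul_nonneg (hf0 q.1) (hk0 q.1 q.2)
    refine (summable_prod_of_nonneg h0).2 ⟨fun x => (hk x).summable.mul_left (f x), ?_⟩
    have e : (fun x => ∑' y, f x * k x y) = f := by
      funext x
      rw [tsum_mul_left, (hk x).tsum_eq, mul_one]
    exact e.symm ▸ hf
  refine Summable.of_nonneg_of_le (fun q => ?_) (fun q => ?_) h1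
  · exact mul_nonneg (mul_nonneg (hf0 _) (hk0 _ _)) (hb0 _)
  · exact mul_le_of_le_one_right (mul_nonneg (hf0 _) (hk0 _ _)) (hb1 _)

lemma aux_swap {f : V → ℝ} {k : V → V → ℝ} {b : V → ℝ} (hf0 : ∀ x, 0 ≤ f x)
    (hf : Summable f) (hk0 : ∀ x y, 0 ≤ k x y) (hk : ∀ x, HasSum (k x) 1)
    (hb0 : ∀ x, 0 ≤ b x) (hb1 : ∀ x, b x ≤ 1) :
    Summable (fun z => (∑' w, f w * k w z) * b z) ∧
    ∑' z, (∑' w, f w * k w z) * b z = ∑' w, f w * ∑' z, k w z * b z := by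
  have h := aux_summable hf0 hf hk0 hk hb0 hb1
  constructor
  · have := (h.prod_symm).prod
    simpa [tsum_mul_right] using this
  · simp_rw [← tsum_mul_right, ← tsum_mul_left, ← mul_assoc]
    exact (Summable.tsum_comm (f := fun w z => f w * k w z * b z) h)

lemma pn_stoch {p : V → V → ℝ} (hp0 : ∀ x y, 0 ≤ p x y) (hp : ∀ x, HasSum (p x) 1) (n : ℕ) :
    (∀ x y, 0 ≤ pn p n x y) ∧ ∀ x, HasSum (pn p n x) 1 := by
  induction n with
  | zero =>
    refine ⟨fun x y => ?_, fun x => ?_⟩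
    · simp only [pn]; split_ifs <;> norm_num
    · have := hasSum_ite_eq x (1 : ℝ)
      simpa [pn, eq_comm] using this
  | succ n ih =>
    refine ⟨fun x y => tsum_nonneg fun z => mul_nonneg (ih.1 _ _) (hp0 _ _), fun x => ?_⟩
    obtain ⟨h1, h2⟩ := aux_swap (b := fun _ => 1) (ih.1 x) (ih.2 x).summable hp0 hp
      (fun _ => zero_le_one) (fun _ => le_rfl)
    simp only [mul_one, (hp _).tsum_eq, (ih.2 x).tsum_eq] at h1 h2
    rw [← h2]
    exact h1.hasSum

lemma aux_le_one {k : V → V → ℝ} (hk0 : ∀ x y, 0 ≤ k x y) (hk : ∀ x, HasSum (k x) 1) (x y : V) :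
    k x y ≤ 1 := le_hasSum (hk x) y (fun z _ => hk0 x z)

lemma pn_succ_left {p : V → V → ℝ} (hp0 : ∀ x y, 0 ≤ p x y) (hp : ∀ x, HasSum (p x) 1) (n : ℕ)
    (x y : V) : pn p (n + 1) x y = ∑' z, p x z * pn p n z y := by
  induction n generalizing y with
  | zero => simp [pn]
  | succ n ih =>
    have h : pn p (n + 1 + 1) x y = ∑' z, pn p (n + 1) x z * p z y := rfl
    rw [h]
    simp_rw [ih]
    rw [(aux_swap (hp0 x) (hp x).summable (pn_stoch hp0 hp n).1 (pn_stoch hp0 hp n).2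
      (fun z => hp0 z y) (fun z => aux_le_one hp0 hp z y)).2]
    rfl

lemma aux_fun (a q c : ℝ) (ha : 0 < a) (hq0 : 0 ≤ q) (hq : q ≤ a) :
    Integrable (fun u : ℝ => if u * a ≤ q then c else 0) (volume.restrict (Ioc 0 1)) ∧
    ∫ u in Ioc (0 : ℝ) 1, (if u * a ≤ q then c else 0) = q / a * c := by
  have e : (fun u : ℝ => if u * a ≤ q then c else 0) = (Iic (q / a)).indicator (fun _ => c) := by
    ext u
    simp [Set.indicator, le_div_iff₀ ha]
  have h1 : q / a ≤ 1 := (div_le_one ha).2 hq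
  rw [e]
  constructor
  · exact (integrable_const c).indicator measurableSet_Iic
  · rw [setIntegral_indicator measurableSet_Iic, Ioc_inter_Iic, min_eq_right h1]
    simp [div_nonneg hq0 ha.le]

lemma key [Countable V] {p : V → V → ℝ} {pi : V → ℝ}
    (hp0 : ∀ x y, 0 ≤ p x y) (hp : ∀ x, HasSum (p x) 1)
    (hpipos : ∀ x, 0 < pi x) (hpi : Summable pi)
    (hstat : ∀ y, ∑' x, pi x * p x y = pi y) (y : V) (n : ℕ) (S : Set V) :
    esE pi p n (fun T => if y ∈ T then (1 : ℝ) else 0) S =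
      (∑' z, S.indicator pi z * pn p n z y) / pi y := by
  induction n generalizing S with
  | zero =>
    simp only [esE, pn]
    have : ∀ z, S.indicator pi z * (if z = y then (1:ℝ) else 0) =
        if z = y then S.indicator pi y else 0 := by
      intro z; split_ifs with h <;> simp [h]
    simp_rw [this, tsum_ite_eq]
    by_cases h : y ∈ S <;> simp [h, (hpipos y).ne']
  | succ n ih =>
    have hst := pn_stoch hp0 hp n
    have hb1 : ∀ z, pn p n z y ≤ 1 := fun z => aux_le_one hst.1 hst.2 z y
    have hi0 : ∀ z, 0 ≤ S.indicator pi z := fun z =>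
      Set.indicator_nonneg (fun z _ => (hpipos z).le) z
    have hQ : ∀ z, QS pi p S z = ∑' s, S.indicator pi s * p s z := by
      intro z
      rw [QS, tsum_subtype S (fun s => pi s * p s z)]
      refine tsum_congr fun s => ?_
      by_cases h : s ∈ S <;> simp [h]
    have hsum : ∀ z, Summable fun s => pi s * p s z := fun z =>
      Summable.of_nonneg_of_le (fun s => mul_nonneg (hpipos s).le (hp0 _ _))
        (fun s => mul_le_of_le_one_right (hpipos s).le (aux_le_one hp0 hp s z)) hpi
    have hle : ∀ z s, S.indicator pi s * p s z ≤ pi s * p s z := fun z s =>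
      mul_le_mul_of_nonneg_right (Set.indicator_le_self' (fun s _ => (hpipos s).le) s) (hp0 _ _)
    have hQ0 : ∀ z, 0 ≤ QS pi p S z := fun z => by
      rw [hQ]; exact tsum_nonneg fun s => mul_nonneg (hi0 s) (hp0 _ _)
    have hQ1 : ∀ z, QS pi p S z ≤ pi z := fun z => by
      rw [hQ]
      refine (Summable.tsum_le_tsum (hle z) ?_ (hsum z)).trans_eq (hstat z)
      exact Summable.of_nonneg_of_le (fun s => mul_nonneg (hi0 s) (hp0 _ _)) (hle z) (hsum z)
    have hsw := aux_swap hi0 (hpi.indicator S) hp0 hp (fun z => hst.1 z y) hb1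
    have hF : ∀ z, (Integrable (fun u : ℝ => if u * pi z ≤ QS pi p S z then pi z * pn p n z y else 0)
        (volume.restrict (Ioc 0 1)) ∧ ∫ u in Ioc (0 : ℝ) 1,
          (if u * pi z ≤ QS pi p S z then pi z * pn p n z y else 0)
            = QS pi p S z * pn p n z y) := by
      intro z
      obtain ⟨h1, h2⟩ := aux_fun (pi z) (QS pi p S z) (pi z * pn p n z y) (hpipos z) (hQ0 z) (hQ1 z)
      refine ⟨h1, h2.trans ?_⟩
      have := (hpipos z).ne'
      field_simp
    have hint := hasSum_integral_of_summable_integral_norm (fun z => (hF z).1) (by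
      have : ∀ z, ∫ u in Ioc (0 : ℝ) 1,
          ‖(if u * pi z ≤ QS pi p S z then pi z * pn p n z y else 0)‖
            = QS pi p S z * pn p n z y := by
        intro z
        rw [← (hF z).2]
        refine integral_congr_ae (Filter.Eventually.of_forall fun u => ?_)
        refine Real.norm_of_nonneg ?_
        have := mul_nonneg (hpipos z).le (hst.1 z y)
        split_ifs <;> simp [this]
      simp_rw [this, hQ]
      exact hsw.1)
    simp only [esE]
    simp_rw [ih]
    rw [intervalIntegral.integral_div, intervalIntegral.integral_of_le zero_le_one]
    congr 1
    calc _ = ∫ u in Ioc (0 : ℝ) 1, ∑' z,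
          (if u * pi z ≤ QS pi p S z then pi z * pn p n z y else 0) := by
          refine integral_congr_ae (Filter.Eventually.of_forall fun u => ?_)
          refine tsum_congr fun z => ?_
          by_cases h : u * pi z ≤ QS pi p S z <;> simp [Set.indicator, esStep, h]
      _ = ∑' z, QS pi p S z * pn p n z y := by
          rw [← hint.tsum_eq]
          exact tsum_congr fun z => (hF z).2
      _ = _ := by
          simp_rw [hQ, pn_succ_left hp0 hp]
          exact hsw.2

/-- Proposition (keyprop): `p^n(x,y) = (π(y)/π(x)) P_{{x}}(y ∈ S_n)`. -/
theorem pn_eq_evolving_set_prob [Countable V]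
    (p : V → V → ℝ) (pi : V → ℝ)
    (hp0 : ∀ x y, 0 ≤ p x y) (hp1 : ∀ x, ∑' y, p x y = 1)
    (hpipos : ∀ x, 0 < pi x) (hpi1 : ∑' x, pi x = 1)
    (hstat : ∀ y, ∑' x, pi x * p x y = pi y)
    (hirr : ∀ x y : V, ∃ n, 0 < pn p n x y)
    (n : ℕ) (x y : V) :
    pn p n x y =
      pi y / pi x * esE pi p n (fun T => if y ∈ T then (1 : ℝ) else 0) {x} := by
  have hp : ∀ x, HasSum (p x) 1 := fun x => by
    have hs : Summable (p x) := by
      by_contra h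
      have := hp1 x
      rw [tsum_eq_zero_of_not_summable h] at this
      exact zero_ne_one this
    rw [← hp1 x]; exact hs.hasSum
  have hpi : Summable pi := by
    by_contra h
    rw [tsum_eq_zero_of_not_summable h] at hpi1
    exact zero_ne_one hpi1
  rw [key hp0 hp hpipos hpi hstat y n {x}, tsum_eq_single x (by
    intro z hz
    simp [hz])]
  have h1 := (hpipos x).ne'
  have h2 := (hpipos y).ne'
  simp only [Set.mem_singleton_iff, Set.indicator_of_mem]
  field_simp

end EvolvingSetsPaper
end

section
/- The sequence (π(S_n))_{n≥0} is a martingale for the evolving set process; equivalently, for every S ⊆ V, the one-step expectation satisfies E_S π(S̃) = ∫_0^1 π({y ∈ V : Q(S,y) ≥ u π(y)}) du = π(S). -/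
open MeasureTheory Set
open scoped ENNReal Classical

namespace EvolvingSetsPaper

variable {V : Type*}

theorem summable_of_tsum_pos' {ι : Type*} (f : ι → ℝ) (h : 0 < ∑' i, f i) : Summable f := by
  by_contra hc
  rw [tsum_eq_zero_of_not_summable hc] at h
  exact lt_irrefl _ h

theorem step_integral (a q : ℝ) (ha : 0 < a) (h0 : 0 ≤ q) (h1 : q ≤ a) :
    ∫ u in (0:ℝ)..1, (if u * a ≤ q then a else 0) = q := by
  have hq0 : 0 ≤ q / a := by positivity
  have hq1 : q / a ≤ 1 := by rw [div_le_one ha]; exact h1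
  rw [intervalIntegral.integral_of_le zero_le_one]
  have : (fun u : ℝ => if u * a ≤ q then a else 0) = (Set.Iic (q / a)).indicator (fun _ => a) := by
    ext u
    simp only [Set.indicator, Set.mem_Iic, le_div_iff₀ ha]
  rw [this, setIntegral_indicator measurableSet_Iic]
  have h2 : Set.Ioc (0:ℝ) 1 ∩ Set.Iic (q / a) = Set.Ioc 0 (q / a) := by
    ext u
    simp only [Set.mem_inter_iff, Set.mem_Ioc, Set.mem_Iic]
    constructor
    · rintro ⟨⟨h, _⟩, h'⟩; exact ⟨h, h'⟩
    · rintro ⟨h, h'⟩; exact ⟨⟨h, h'.trans hq1⟩, h'⟩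
  rw [h2]
  simp [hq0]
  field_simp

theorem one_step [Countable V]
    (p : V → V → ℝ) (pi : V → ℝ)
    (hp0 : ∀ x y, 0 ≤ p x y) (hp1 : ∀ x, ∑' y, p x y = 1)
    (hpipos : ∀ x, 0 < pi x) (hpi1 : ∑' x, pi x = 1)
    (hstat : ∀ y, ∑' x, pi x * p x y = pi y) (S : Set V) :
    (∫ u in (0:ℝ)..1, piS pi (esStep pi p S u)) = piS pi S := by
  have spi : Summable pi := summable_of_tsum_pos' _ (by rw [hpi1]; exact one_pos)
  have sp : ∀ x, Summable (p x) := fun x => summable_of_tsum_pos' _ (by rw [hp1]; exact one_pos)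
  have sq : ∀ y, Summable (fun x => pi x * p x y) := fun y =>
    summable_of_tsum_pos' _ (by rw [hstat]; exact hpipos y)
  have hQ0 : ∀ y, 0 ≤ QS pi p S y := fun y =>
    tsum_nonneg fun s => mul_nonneg (hpipos _).le (hp0 _ _)
  have hQ1 : ∀ y, QS pi p S y ≤ pi y := fun y => by
    rw [← hstat y]
    exact Summable.tsum_subtype_le (fun x => pi x * p x y) S
      (fun x => mul_nonneg (hpipos _).le (hp0 _ _)) (sq y)
  have hQsum : ∑' y, QS pi p S y = piS pi S := by
    unfold QS piS
    have : Summable (Function.uncurry fun (s : S) (y : V) => pi s * p s y) := by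
      refine (summable_prod_of_nonneg
        (f := Function.uncurry fun (s : S) (y : V) => pi s * p s y) ?_).2 ⟨?_, ?_⟩
      · intro x; exact mul_nonneg (hpipos x.1).le (hp0 x.1 x.2)
      · intro s; exact (sp s).mul_left (pi s)
      · simp only [Function.uncurry_apply_pair, tsum_mul_left, hp1, mul_one]
        exact spi.subtype S
    rw [this.tsum_comm]
    simp only [tsum_mul_left, hp1, mul_one]
  have hpiS : ∀ u, piS pi (esStep pi p S u) =
      ∑' y, (if u * pi y ≤ QS pi p S y then pi y else 0) := fun u => by
    unfold piS
    rw [tsum_subtype]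
    rfl
  have hm : ∀ y, Measurable (fun u : ℝ => if u * pi y ≤ QS pi p S y then pi y else 0) := fun y =>
    Measurable.ite (measurableSet_le (by fun_prop) measurable_const) measurable_const
      measurable_const
  have hb : ∀ y (u : ℝ), ‖(if u * pi y ≤ QS pi p S y then pi y else 0)‖ ≤ pi y := fun y u => by
    split_ifs
    · rw [Real.norm_of_nonneg (hpipos y).le]
    · simpa using (hpipos y).le
  have key := intervalIntegral.hasSum_integral_of_dominated_convergence (μ := volume)
    (a := 0) (b := 1)
    (F := fun y (u : ℝ) => if u * pi y ≤ QS pi p S y then pi y else 0)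
    (f := fun u => piS pi (esStep pi p S u)) (fun y _ => pi y)
    (fun y => (hm y).aestronglyMeasurable)
    (fun y => Filter.Eventually.of_forall fun u _ => hb y u)
    (Filter.Eventually.of_forall fun u _ => spi)
    (by simp)
    (Filter.Eventually.of_forall fun u _ => by
      rw [hpiS]
      exact (Summable.of_norm_bounded spi (fun y => hb y u)).hasSum)
  rw [← key.tsum_eq, ← hQsum]
  exact tsum_congr fun y => step_integral _ _ (hpipos y) (hQ0 y) (hQ1 y)

/-- Lemma (lem:mart): `(π(S_n))` is a martingale for the evolving set process;
equivalently the one-step expectation satisfies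
`E_S π(S̃) = ∫_0^1 π({y : Q(S,y) ≥ u π(y)}) du = π(S)`. -/
theorem evolving_set_martingale [Countable V]
    (p : V → V → ℝ) (pi : V → ℝ)
    (hp0 : ∀ x y, 0 ≤ p x y) (hp1 : ∀ x, ∑' y, p x y = 1)
    (hpipos : ∀ x, 0 < pi x) (hpi1 : ∑' x, pi x = 1)
    (hstat : ∀ y, ∑' x, pi x * p x y = pi y)
    (hirr : ∀ x y : V, ∃ n, 0 < pn p n x y) :
    (∀ S : Set V,
        (∫ u in (0:ℝ)..1, piS pi (esStep pi p S u)) = piS pi S) ∧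
      (∀ (n : ℕ) (S : Set V),
        esE pi p (n + 1) (piS pi) S = esE pi p n (piS pi) S) := by
  have h1 := one_step p pi hp0 hp1 hpipos hpi1 hstat
  have h2 : ∀ (n : ℕ) (S : Set V), esE pi p n (piS pi) S = piS pi S := by
    intro n
    induction n with
    | zero => intro S; rfl
    | succ n ih =>
      intro S
      simp only [esE, ih]
      exact h1 S
  exact ⟨h1, fun n S => by rw [h2, h2]⟩

end EvolvingSetsPaper
end

section
/- The evolving set process is self-dual under complementation: its one-step transition kernel K(S,A) = P_S(S̃ = A) satisfies K(S,A) = K(S^c, A^c) for all S, A ⊆ V. Consequently, if (S_n) is an evolving set process, then the sequence of complements (S_n^c) is also an evolving set process with the same transition probabilities. -/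
open MeasureTheory Set
open scoped ENNReal Classical

namespace EvolvingSetsPaper

variable {V : Type*}

/-- The one-step transition kernel of the evolving set process:
`K(S, A) = P_S(S̃ = A)`, the probability that a uniform `U ∈ [0,1]` produces
`S̃ = A`. -/
noncomputable def K (pi : V → ℝ) (p : V → V → ℝ) (S A : Set V) : ℝ≥0∞ :=
  volume {u ∈ Icc (0:ℝ) 1 | esStep pi p S u = A}

theorem QS_compl (p : V → V → ℝ) (pi : V → ℝ) (hpipos : ∀ x, 0 < pi x)
    (hstat : ∀ y, ∑' x, pi x * p x y = pi y) (S : Set V) (y : V) :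
    QS pi p S y + QS pi p Sᶜ y = pi y := by
  have hs : Summable (fun x => pi x * p x y) := by
    by_contra h
    have h1 := hstat y
    rw [tsum_eq_zero_of_not_summable h] at h1
    exact absurd h1 (hpipos y).ne
  rw [← hstat y]
  exact (hs.subtype S).tsum_add_tsum_compl (hs.subtype Sᶜ)

theorem esStep_compl_ae [Countable V] (p : V → V → ℝ) (pi : V → ℝ) (hpipos : ∀ x, 0 < pi x)
    (hstat : ∀ y, ∑' x, pi x * p x y = pi y) (S : Set V) :
    ∀ᵐ u : ℝ, (esStep pi p S u)ᶜ = esStep pi p Sᶜ (1 - u) := by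
  have h : ∀ᵐ u : ℝ, u ∉ Set.range (fun y => QS pi p S y / pi y) :=
    (Set.countable_range _).ae_notMem volume
  filter_upwards [h] with u hu
  ext y
  have h1 := QS_compl p pi hpipos hstat S y
  have h2 : u * pi y ≠ QS pi p S y := by
    intro h3
    apply hu
    refine ⟨y, ?_⟩
    show QS pi p S y / pi y = u
    rw [← h3, mul_div_cancel_right₀ _ (hpipos y).ne']
  simp only [esStep, mem_compl_iff, mem_setOf_eq, not_le]
  constructor
  · intro h3
    linarith
  · intro h3
    exact lt_of_le_of_ne (by linarith) h2.symm

/-- Lemma (comp): the evolving set process is self-dual under complementation: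
`K(S,A) = K(Sᶜ,Aᶜ)`, and consequently the complements `(S_nᶜ)` form an evolving
set process with the same transition probabilities. -/
theorem evolving_set_complement_duality [Countable V]
    (p : V → V → ℝ) (pi : V → ℝ)
    (hp0 : ∀ x y, 0 ≤ p x y) (hp1 : ∀ x, ∑' y, p x y = 1)
    (hpipos : ∀ x, 0 < pi x) (hpi1 : ∑' x, pi x = 1)
    (hstat : ∀ y, ∑' x, pi x * p x y = pi y)
    (hirr : ∀ x y : V, ∃ n, 0 < pn p n x y) :
    (∀ S A : Set V, K pi p S A = K pi p Sᶜ Aᶜ) ∧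
      (∀ (n : ℕ) (F : Set V → ℝ) (S : Set V),
        esE pi p n (fun T => F Tᶜ) S = esE pi p n F Sᶜ) := by
  have key := esStep_compl_ae p pi hpipos hstat
  constructor
  · intro S A
    have h1 : K pi p Sᶜ Aᶜ =
        volume ((fun u : ℝ => 1 - u) ⁻¹' {u ∈ Icc (0:ℝ) 1 | esStep pi p Sᶜ u = Aᶜ}) :=
      ((Measure.measurePreserving_sub_left volume (1:ℝ)).measure_preimage_emb
        (MeasurableEquiv.subLeft (1:ℝ)).measurableEmbedding _).symm
    rw [h1]
    apply measure_congr
    filter_upwards [key S] with u hu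
    apply propext
    show (u ∈ Icc (0:ℝ) 1 ∧ esStep pi p S u = A) ↔
      (1 - u ∈ Icc (0:ℝ) 1 ∧ esStep pi p Sᶜ (1 - u) = Aᶜ)
    rw [← hu, compl_inj_iff, mem_Icc, mem_Icc]
    constructor
    · rintro ⟨⟨a, b⟩, c⟩
      exact ⟨⟨by linarith, by linarith⟩, c⟩
    · rintro ⟨⟨a, b⟩, c⟩
      exact ⟨⟨by linarith, by linarith⟩, c⟩
  · intro n F
    induction n with
    | zero => intro S; rfl
    | succ n ih =>
      intro S
      show (∫ u in (0:ℝ)..1, esE pi p n (fun T => F Tᶜ) (esStep pi p S u)) =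
        ∫ u in (0:ℝ)..1, esE pi p n F (esStep pi p Sᶜ u)
      have h2 := intervalIntegral.integral_comp_sub_left (a := 0) (b := 1)
        (fun u => esE pi p n F (esStep pi p Sᶜ u)) (1:ℝ)
      rw [sub_self, sub_zero] at h2
      rw [← h2]
      apply intervalIntegral.integral_congr_ae
      filter_upwards [key S] with u hu _
      rw [ih, hu]

end EvolvingSetsPaper
end

section
/- For every ∅ ≠ S ⊆ V, with φ_S = (1/(2π(S))) Σ_{y∈V} min(Q(S,y), Q(S^c,y)), one has 1 − ψ(S) ≤ (√(1+2φ_S) + √(1−2φ_S))/2 ≤ 1 − φ_S²/2. -/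
open MeasureTheory Set
open scoped ENNReal Classical

namespace EvolvingSetsPaper

variable {V : Type*}

lemma aux_term (a q t : ℝ) (ha : 0 < a) (hq : 0 ≤ q) (ht : 0 ≤ t) :
    ∫ u in (0:ℝ)..t, (if u * a ≤ q then a else 0) = min (t * a) q := by
  have hm : (0:ℝ) ≤ min t (q / a) := le_min ht (by positivity)
  have h1 : ∫ u in (0:ℝ)..t, (if u * a ≤ q then a else 0)
      = ∫ u in (0:ℝ)..(min t (q / a)), a := by
    rw [intervalIntegral.integral_of_le ht, intervalIntegral.integral_of_le hm]
    have : (fun u : ℝ => if u * a ≤ q then a else 0)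
        = (Set.Iic (q / a)).indicator (fun _ => a) := by
      funext u
      simp only [Set.indicator, Set.mem_Iic, le_div_iff₀ ha]
    rw [this, MeasureTheory.setIntegral_indicator measurableSet_Iic, Set.Ioc_inter_Iic]
  rw [h1, intervalIntegral.integral_const, sub_zero, smul_eq_mul,
    min_mul_of_nonneg _ _ ha.le, div_mul_cancel₀ _ ha.ne']

lemma aux_integral [Countable V] (pi q : V → ℝ) (hpipos : ∀ x, 0 < pi x) (hs : Summable pi)
    (hq : ∀ y, 0 ≤ q y) (t : ℝ) (ht : 0 ≤ t) :
    HasSum (fun y => min (t * pi y) (q y))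
      (∫ u in (0:ℝ)..t, piS pi {y | u * pi y ≤ q y}) := by
  have h := intervalIntegral.hasSum_integral_of_dominated_convergence
    (μ := volume) (a := 0) (b := t)
    (F := fun (y : V) (u : ℝ) => if u * pi y ≤ q y then pi y else 0)
    (f := fun u => piS pi {y | u * pi y ≤ q y})
    (fun y _ => pi y) ?_ ?_ ?_ ?_ ?_
  · simpa only [aux_term _ _ t (hpipos _) (hq _) ht] using h
  · intro y
    refine Measurable.aestronglyMeasurable ?_
    refine Measurable.ite ?_ measurable_const measurable_const
    exact measurableSet_le (by fun_prop) (by fun_prop)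
  · intro y
    refine Filter.Eventually.of_forall fun u _ => ?_
    have := (hpipos y).le
    split_ifs
    · simp [abs_of_nonneg this]
    · simpa using this
  · exact Filter.Eventually.of_forall fun u _ => hs
  · simp
  · refine Filter.Eventually.of_forall fun u _ => ?_
    have e : (fun y => if u * pi y ≤ q y then pi y else 0)
        = ({y | u * pi y ≤ q y} : Set V).indicator pi := by
      funext y
      simp only [Set.indicator, Set.mem_ofPred_eq]
    rw [e]
    unfold piS
    rw [tsum_subtype]
    exact (hs.indicator _).hasSum

lemma aux_jensen (f : ℝ → ℝ) (hf : ∀ u, 0 ≤ f u) (hanti : Antitone f) (a b c : ℝ) (hab : b = a + 1/2)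
    (hc : ∫ u in a..b, f u = c / 2) : 0 ≤ c ∧ ∫ u in a..b, √(f u) ≤ √c / 2 := by
  have hle : a ≤ b := by linarith
  have hint : ∀ a b, IntervalIntegrable f volume a b := fun a b => hanti.intervalIntegrable
  have hsint : IntervalIntegrable (fun u => √(f u)) volume a b :=
    Antitone.intervalIntegrable (fun x y h => Real.sqrt_le_sqrt (hanti h))
  have hc0 : 0 ≤ c := by
    have := intervalIntegral.integral_nonneg (μ := volume) hle (fun u _ => hf u)
    linarith
  have key : ∀ ε : ℝ, 0 < ε → ∫ u in a..b, √(f u) ≤ (c / ε + ε) / 4 := by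
    intro ε hε
    have : ∫ u in a..b, √(f u) ≤ ∫ u in a..b, ((1 / (2*ε)) * f u + ε / 2) := by
      refine intervalIntegral.integral_mono_on hle hsint
        (((hint a b).const_mul _).add (by simp)) ?_
      intro u _
      have h2 := Real.sq_sqrt (hf u)
      have : (1 / (2*ε)) * f u + ε / 2 - √(f u) = (√(f u) - ε)^2 / (2*ε) := by
        field_simp
        nlinarith
      have : 0 ≤ (√(f u) - ε)^2 / (2*ε) := by positivity
      linarith
    rw [intervalIntegral.integral_add ((hint a b).const_mul _) (by simp),
      intervalIntegral.integral_const_mul, hc, intervalIntegral.integral_const, show b - a = 1 / 2 by linarith] at this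
    refine this.trans (le_of_eq ?_)
    simp only [smul_eq_mul]
    field_simp
    ring
  refine ⟨hc0, ?_⟩
  rcases hc0.eq_or_lt with h | h
  · rw [← h] at key ⊢
    refine le_of_forall_pos_le_add fun ε hε => ?_
    have := key ε hε
    simp at this ⊢
    linarith
  · have h0 : 0 < √c := Real.sqrt_pos.2 h
    have := key _ h0
    rw [Real.div_sqrt] at this
    linarith

lemma aux_alg_s9 (x : ℝ) (h1 : 0 ≤ 1 + 2 * x) (h2 : 0 ≤ 1 - 2 * x) :
    (√(1 + 2 * x) + √(1 - 2 * x)) / 2 ≤ 1 - x ^ 2 / 2 := by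
  have ha := Real.sq_sqrt h1
  have hb := Real.sq_sqrt h2
  set a := √(1 + 2 * x)
  set b := √(1 - 2 * x)
  have ha0 : 0 ≤ a := Real.sqrt_nonneg _
  have hb0 : 0 ≤ b := Real.sqrt_nonneg _
  have hx : x ^ 2 ≤ 1 / 4 := by nlinarith
  have hab : a * b ≤ 1 - 2 * x ^ 2 := by
    apply le_of_sq_le_sq _ (by linarith)
    have : (a*b)^2 = (1+2*x)*(1-2*x) := by rw [mul_pow, ha, hb]
    nlinarith [sq_nonneg (x^2)]
  have : a + b ≤ 2 - x ^ 2 := by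
    apply le_of_sq_le_sq _ (by linarith)
    nlinarith [sq_nonneg (x^2)]
  linarith

lemma aux_QS_sum (p : V → V → ℝ) (pi : V → ℝ)
    (hp0 : ∀ x y, 0 ≤ p x y) (hp1 : ∀ x, ∑' y, p x y = 1)
    (hpipos : ∀ x, 0 < pi x) (hs : Summable pi) (S : Set V) :
    ∑' y, QS pi p S y = piS pi S := by
  have hps : ∀ x, Summable (p x) := fun x => by
    by_contra h
    have := hp1 x
    rw [tsum_eq_zero_of_not_summable h] at this
    norm_num at this
  have hsum : Summable (Function.uncurry fun (s : S) (y : V) => pi s * p s y) := by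
    have h0 : 0 ≤ (Function.uncurry fun (s : S) (y : V) => pi s * p s y) := by
      rintro ⟨s, y⟩
      exact mul_nonneg (hpipos s).le (hp0 s y)
    refine (summable_prod_of_nonneg h0).2 ⟨fun s => (hps s).mul_left (pi s), ?_⟩
    have e : (fun s : S => ∑' y, (Function.uncurry fun (s : S) (y : V) => pi s * p s y) (s, y))
        = fun s : S => pi s := by
      funext s
      simp only [Function.uncurry_apply_pair]
      rw [tsum_mul_left, hp1, mul_one]
    rw [e]
    exact hs.subtype S
  unfold QS piS
  rw [hsum.tsum_comm]
  simp only [tsum_mul_left, hp1, mul_one]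

/-- Lemma (lemphi): `1 - ψ(S) ≤ (√(1+2φ_S) + √(1-2φ_S))/2 ≤ 1 - φ_S²/2`. -/
theorem one_sub_psiSet_le [Countable V]
    (p : V → V → ℝ) (pi : V → ℝ)
    (hp0 : ∀ x y, 0 ≤ p x y) (hp1 : ∀ x, ∑' y, p x y = 1)
    (hpipos : ∀ x, 0 < pi x) (hpi1 : ∑' x, pi x = 1)
    (hstat : ∀ y, ∑' x, pi x * p x y = pi y)
    (hirr : ∀ x y : V, ∃ n, 0 < pn p n x y)
    (S : Set V) (hS : S.Nonempty) :
    1 - psiSet pi p S ≤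
        (Real.sqrt (1 + 2 * phiS pi p S) + Real.sqrt (1 - 2 * phiS pi p S)) / 2 ∧
      (Real.sqrt (1 + 2 * phiS pi p S) + Real.sqrt (1 - 2 * phiS pi p S)) / 2 ≤
        1 - phiS pi p S ^ 2 / 2 := by
  have hs : Summable pi := by
    by_contra h
    rw [tsum_eq_zero_of_not_summable h] at hpi1
    norm_num at hpi1
  have hsq : ∀ y, Summable fun x => pi x * p x y := fun y => by
    by_contra h
    have h1 := hstat y
    rw [tsum_eq_zero_of_not_summable h] at h1
    exact (hpipos y).ne h1
  have hQ0 : ∀ T y, 0 ≤ QS pi p T y := fun T y =>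
    tsum_nonneg fun s => mul_nonneg (hpipos _).le (hp0 _ _)
  have hQadd : ∀ y, QS pi p S y + QS pi p Sᶜ y = pi y := fun y => by
    rw [← hstat y]
    exact Summable.tsum_add_tsum_compl ((hsq y).subtype S) ((hsq y).subtype Sᶜ)
  have hQle : ∀ y, QS pi p S y ≤ pi y := fun y => by
    linarith [hQadd y, hQ0 Sᶜ y]
  have hQs : Summable (QS pi p S) := Summable.of_nonneg_of_le (hQ0 S) hQle hs
  have hQsum := aux_QS_sum p pi hp0 hp1 hpipos hs S
  have hpS : 0 < piS pi S := by
    obtain ⟨x, hx⟩ := hS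
    exact (hs.subtype S).tsum_pos (fun y => (hpipos _).le) ⟨x, hx⟩ (hpipos x)
  set P := piS pi S with hP
  set f : ℝ → ℝ := fun u => piS pi (esStep pi p S u) / P with hf
  have hf0 : ∀ u, 0 ≤ f u := fun u =>
    div_nonneg (tsum_nonneg fun y => (hpipos _).le) hpS.le
  have hanti : Antitone f := by
    intro u v huv
    refine div_le_div_of_nonneg_right ?_ hpS.le
    unfold piS
    rw [tsum_subtype, tsum_subtype]
    refine Summable.tsum_le_tsum (fun y => ?_) (hs.indicator _) (hs.indicator _)
    refine Set.indicator_le_indicator_of_subset ?_ (fun y => (hpipos y).le) y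
    intro z hz
    exact (mul_le_mul_of_nonneg_right huv (hpipos z).le).trans hz
  have hfull : ∫ u in (0:ℝ)..1, f u = 1 := by
    have h := (aux_integral pi (QS pi p S) hpipos hs (hQ0 S) 1 zero_le_one).tsum_eq
    have e : ∀ y, min (1 * pi y) (QS pi p S y) = QS pi p S y := fun y => by
      rw [one_mul, min_eq_right (hQle y)]
    simp only [e, hQsum] at h
    rw [hf, intervalIntegral.integral_div]
    unfold esStep
    rw [← h, div_self hpS.ne']
  have hhalf : ∫ u in (0:ℝ)..(1/2), f u = (1 + 2 * phiS pi p S) / 2 := by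
    have h := (aux_integral pi (QS pi p S) hpipos hs (hQ0 S) (1/2) (by norm_num)).tsum_eq
    have hms : Summable fun y => min (QS pi p S y) (QS pi p Sᶜ y) :=
      Summable.of_nonneg_of_le (fun y => le_min (hQ0 _ _) (hQ0 _ _))
        (fun y => min_le_left _ _) hQs
    have e : ∀ y, min (1 / 2 * pi y) (QS pi p S y)
        = (QS pi p S y + min (QS pi p S y) (QS pi p Sᶜ y)) / 2 := fun y => by
      have := hQadd y
      rcases le_total (QS pi p S y) (QS pi p Sᶜ y) with h | h
      · rw [min_eq_left h, min_eq_right (by linarith)]; ring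
      · rw [min_eq_right h, min_eq_left (by linarith)]; linarith
    simp only [e] at h
    rw [tsum_div_const, hQs.tsum_add hms, hQsum] at h
    rw [hf, intervalIntegral.integral_div]
    unfold esStep
    rw [← h, phiS, ← hP]
    field_simp
  have hint : ∀ a b, IntervalIntegrable f volume a b := fun a b => hanti.intervalIntegrable
  have hsint : ∀ a b, IntervalIntegrable (fun u => √(f u)) volume a b := fun a b =>
    Antitone.intervalIntegrable (fun x y h => Real.sqrt_le_sqrt (hanti h))
  have hhalf2 : ∫ u in (1/2:ℝ)..1, f u = (1 - 2 * phiS pi p S) / 2 := by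
    have := intervalIntegral.integral_add_adjacent_intervals (hint 0 (1/2)) (hint (1/2) 1)
    linarith
  obtain ⟨c1, j1⟩ := aux_jensen f hf0 hanti 0 (1/2) _ (by norm_num) hhalf
  obtain ⟨c2, j2⟩ := aux_jensen f hf0 hanti (1/2) 1 _ (by norm_num) hhalf2
  refine ⟨?_, aux_alg_s9 _ c1 c2⟩
  have := intervalIntegral.integral_add_adjacent_intervals (hsint 0 (1/2)) (hsint (1/2) 1)
  have hpsi : 1 - psiSet pi p S = ∫ u in (0:ℝ)..1, √(f u) := by
    unfold psiSet
    ring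
  rw [hpsi]
  linarith

end EvolvingSetsPaper
end

section
/- Let ∅ ≠ S ⊆ V and let φ_S = (1/(2π(S))) Σ_{y∈V} min(Q(S,y), Q(S^c,y)). If 0 < γ ≤ 1/2 and p(x,x) ≥ γ for all x ∈ V, then φ_S ≥ (γ/(1−γ)) Φ_S; moreover, if p(x,x) ≥ 1/2 for all x ∈ V, then φ_S = Φ_S. -/
open MeasureTheory Set
open scoped ENNReal Classical

namespace EvolvingSetsPaper

variable {V : Type*}

theorem aux_facts (p : V → V → ℝ) (pi : V → ℝ)
    (hp0 : ∀ x y, 0 ≤ p x y) (hp1 : ∀ x, ∑' y, p x y = 1)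
    (hpipos : ∀ x, 0 < pi x) (hpi1 : ∑' x, pi x = 1)
    (hstat : ∀ y, ∑' x, pi x * p x y = pi y) (S : Set V) :
    Summable pi ∧ (∀ y, 0 ≤ QS pi p S y) ∧ (∀ y, QS pi p S y + QS pi p Sᶜ y = pi y) ∧
    (∀ y ∈ S, pi y * p y y ≤ QS pi p S y) ∧ Summable (QS pi p S) ∧
    ∑' y, QS pi p S y = piS pi S := by
  have spi : Summable pi := by
    by_contra h
    rw [tsum_eq_zero_of_not_summable h] at hpi1
    norm_num at hpi1
  have sp : ∀ x, Summable (p x) := by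
    intro x
    by_contra h
    have := hp1 x
    rw [tsum_eq_zero_of_not_summable h] at this
    norm_num at this
  have q0 : ∀ x y, 0 ≤ pi x * p x y := fun x y => mul_nonneg (hpipos x).le (hp0 x y)
  have rows : ∀ x, HasSum (fun y => pi x * p x y) (pi x) := by
    intro x
    have := (sp x).hasSum.mul_left (pi x)
    rwa [hp1 x, mul_one] at this
  have cols : ∀ y, Summable (fun x => pi x * p x y) := by
    intro y
    by_contra h
    have h2 := hstat y
    rw [tsum_eq_zero_of_not_summable h] at h2
    exact (hpipos y).ne h2
  have sS : Summable (fun z : S × V => pi z.1 * p z.1 z.2) := by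
    rw [summable_prod_of_nonneg (fun z => q0 _ _)]
    refine ⟨fun x => (rows x).summable, ?_⟩
    have : (fun x : S => ∑' y, pi x * p x y) = fun x : S => pi x := by
      funext x; exact (rows x).tsum_eq
    simp only [this]
    exact spi.subtype S
  have nn : ∀ y, 0 ≤ QS pi p S y := fun y => tsum_nonneg fun s => q0 _ _
  refine ⟨spi, nn, ?_, ?_, ?_, ?_⟩
  · intro y
    rw [← hstat y]
    exact ((cols y).subtype S).tsum_add_tsum_compl ((cols y).subtype Sᶜ)
  · intro y hy
    exact ((cols y).subtype S).le_tsum (⟨y, hy⟩ : S) (fun j _ => q0 _ _)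
  · exact sS.prod_symm.prod
  · unfold QS piS
    rw [sS.tsum_comm]
    exact tsum_congr fun x => (rows x).tsum_eq

/-- `φ_S ≥ (γ/(1-γ)) Φ_S` when `p(x,x) ≥ γ` for all `x`, with equality
`φ_S = Φ_S` when `p(x,x) ≥ 1/2` for all `x`. -/
theorem phiS_ge_cond [Countable V]
    (p : V → V → ℝ) (pi : V → ℝ)
    (hp0 : ∀ x y, 0 ≤ p x y) (hp1 : ∀ x, ∑' y, p x y = 1)
    (hpipos : ∀ x, 0 < pi x) (hpi1 : ∑' x, pi x = 1)
    (hstat : ∀ y, ∑' x, pi x * p x y = pi y)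
    (hirr : ∀ x y : V, ∃ n, 0 < pn p n x y)
    (S : Set V) (hS : S.Nonempty) :
    (∀ γ : ℝ, 0 < γ → γ ≤ 1 / 2 → (∀ x, γ ≤ p x x) →
        γ / (1 - γ) * cond pi p S ≤ phiS pi p S) ∧
      ((∀ x, (1 : ℝ) / 2 ≤ p x x) → phiS pi p S = cond pi p S) := by
  obtain ⟨spi, n1, add1, d1, s1, t1⟩ := aux_facts p pi hp0 hp1 hpipos hpi1 hstat S
  obtain ⟨-, n2, -, d2, s2, t2⟩ := aux_facts p pi hp0 hp1 hpipos hpi1 hstat Sᶜ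
  have hpos : 0 < piS pi S := by
    obtain ⟨x, hx⟩ := hS
    exact lt_of_lt_of_le (hpipos x)
      ((spi.subtype S).le_tsum (⟨x, hx⟩ : S) (fun j _ => (hpipos _).le))
  have sm : Summable (fun y => min (QS pi p S y) (QS pi p Sᶜ y)) :=
    s1.of_nonneg_of_le (fun y => le_min (n1 y) (n2 y)) (fun y => min_le_left _ _)
  have hsymm : Qset pi p Sᶜ S = Qset pi p S Sᶜ := by
    have e1 : Qset pi p S S + Qset pi p S Sᶜ = piS pi S := by
      rw [← t1]
      exact (s1.subtype S).tsum_add_tsum_compl (s1.subtype Sᶜ)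
    have e2 : Qset pi p S S + Qset pi p Sᶜ S = piS pi S := by
      unfold Qset
      refine (Summable.tsum_add (s1.subtype S) (s2.subtype S)).symm.trans ?_
      exact tsum_congr fun y => add1 y.1
    linarith
  have hsplit : ∑' y, min (QS pi p S y) (QS pi p Sᶜ y) =
      ∑' y : S, min (QS pi p S y) (QS pi p Sᶜ y) +
      ∑' y : (Sᶜ : Set V), min (QS pi p S y) (QS pi p Sᶜ y) :=
    ((sm.subtype S).tsum_add_tsum_compl (sm.subtype Sᶜ)).symm
  constructor
  · intro γ h0 h1 hg
    have hc : γ / (1 - γ) ≤ 1 := by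
      rw [div_le_one (by linarith)]; linarith
    have key : ∀ a b π : ℝ, 0 ≤ b → a + b = π → γ * π ≤ a → γ / (1 - γ) * b ≤ min a b := by
      intro a b π hb hab ha
      refine le_min ?_ (mul_le_of_le_one_left hb hc)
      rw [div_mul_eq_mul_div, div_le_iff₀ (by linarith)]
      subst hab
      linarith
    have i1 : γ / (1 - γ) * Qset pi p Sᶜ S ≤
        ∑' y : S, min (QS pi p S y) (QS pi p Sᶜ y) := by
      unfold Qset
      rw [← tsum_mul_left]
      refine Summable.tsum_le_tsum (fun y => ?_) ((s2.subtype S).mul_left _) (sm.subtype S)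
      refine key _ _ (pi y) (n2 y) (add1 y) (le_trans ?_ (d1 y y.2))
      rw [mul_comm]
      exact mul_le_mul_of_nonneg_left (hg y) (hpipos y).le
    have i2 : γ / (1 - γ) * Qset pi p S Sᶜ ≤
        ∑' y : (Sᶜ : Set V), min (QS pi p S y) (QS pi p Sᶜ y) := by
      unfold Qset
      rw [← tsum_mul_left]
      refine Summable.tsum_le_tsum (fun y => ?_) ((s1.subtype Sᶜ).mul_left _) (sm.subtype Sᶜ)
      rw [min_comm]
      refine key _ _ (pi y) (n1 y) (by rw [add_comm]; exact add1 y) (le_trans ?_ (d2 y y.2))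
      rw [mul_comm]
      exact mul_le_mul_of_nonneg_left (hg y) (hpipos y).le
    unfold phiS cond
    rw [hsymm] at i1
    rw [← mul_div_assoc, one_div_mul_eq_div, div_le_div_iff₀ hpos (by linarith), hsplit]
    nlinarith
  · intro hg
    have i1 : ∑' y : S, min (QS pi p S y) (QS pi p Sᶜ y) = Qset pi p Sᶜ S := by
      refine tsum_congr fun y => min_eq_right ?_
      have := d1 y y.2
      have := add1 y
      nlinarith [hg y, hpipos y]
    have i2 : ∑' y : (Sᶜ : Set V), min (QS pi p S y) (QS pi p Sᶜ y) = Qset pi p S Sᶜ := by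
      refine tsum_congr fun y => min_eq_left ?_
      have := d2 y y.2
      have := add1 y
      nlinarith [hg y, hpipos y]
    unfold phiS cond
    rw [hsplit, i1, i2, hsymm]
    field_simp
    ring

end EvolvingSetsPaper
end

section
/- Let f : [0,∞) → [0,1] be an increasing function, let (L_n)_{n≥0} be a sequence of nonnegative real numbers satisfying L_n − L_{n+1} ≥ L_n f(L_n) for all n ≥ 0, and let δ > 0. Then for every n ≥ ∫_δ^{L_0} dz/(z f(z)), one has L_n ≤ δ. -/
open MeasureTheory Set
open scoped ENNReal

theorem aux_lower (f : ℝ → ℝ) (hf0 : ∀ z, 0 ≤ z → 0 ≤ f z)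
    (hfmono : MonotoneOn f (Ici (0 : ℝ))) (a b : ℝ) (ha : 0 < a) :
    ENNReal.ofReal (b - a) / ENNReal.ofReal (b * f b) ≤
      ∫⁻ z in Ioc a b, 1 / ENNReal.ofReal (z * f z) := by
  calc ENNReal.ofReal (b - a) / ENNReal.ofReal (b * f b)
      = ∫⁻ z in Ioc a b, 1 / ENNReal.ofReal (b * f b) := by
        rw [setLIntegral_const, Real.volume_Ioc, one_div, div_eq_mul_inv]; exact mul_comm _ _
    _ ≤ _ := by
        apply setLIntegral_mono' measurableSet_Ioc
        intro z hz
        have hz0 : 0 < z := ha.trans hz.1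
        have hb0 : 0 ≤ b := hz0.le.trans hz.2
        apply ENNReal.div_le_div_left
        apply ENNReal.ofReal_le_ofReal
        exact mul_le_mul hz.2 (hfmono hz0.le hb0 hz.2) (hf0 z hz0.le) hb0

/-- Lemma (rr)(i): if `f : [0,∞) → [0,1]` is increasing and the nonnegative
sequence `(L_n)` satisfies `L_n - L_{n+1} ≥ L_n f(L_n)`, then `L_n ≤ δ` for
every `n ≥ ∫_δ^{L_0} dz/(z f(z))`. -/
theorem seq_le_of_integral_le (f : ℝ → ℝ)
    (hf0 : ∀ z, 0 ≤ z → 0 ≤ f z) (hf1 : ∀ z, 0 ≤ z → f z ≤ 1)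
    (hfmono : MonotoneOn f (Ici (0 : ℝ)))
    (L : ℕ → ℝ) (hL : ∀ n, 0 ≤ L n)
    (hrec : ∀ n, L n * f (L n) ≤ L n - L (n + 1))
    (δ : ℝ) (hδ : 0 < δ) :
    ∀ n : ℕ,
      (∫⁻ z in Ioc δ (L 0), 1 / ENNReal.ofReal (z * f z)) ≤ (n : ℝ≥0∞) →
      L n ≤ δ := by
  have hstep : ∀ n, L (n + 1) ≤ L n := fun n => by
    have := mul_nonneg (hL n) (hf0 _ (hL n))
    have := hrec n
    linarith
  have key : ∀ n : ℕ, δ < L n →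
      (n : ℝ≥0∞) + (∫⁻ z in Ioc δ (L n), 1 / ENNReal.ofReal (z * f z)) ≤
        ∫⁻ z in Ioc δ (L 0), 1 / ENNReal.ofReal (z * f z) := by
    intro n
    induction n with
    | zero => intro _; simp
    | succ n ih =>
      intro h
      have hn : δ < L n := h.trans_le (hstep n)
      refine le_trans ?_ (ih hn)
      rw [Nat.cast_succ, add_assoc]
      gcongr
      have hLn : 0 < L n := hδ.trans hn
      rcases (hf0 _ (hL n)).eq_or_lt with h0 | h0
      · have := aux_lower f hf0 hfmono δ (L n) hδ
        rw [← h0, mul_zero, ENNReal.ofReal_zero, ENNReal.div_zero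
          (by simpa using hn)] at this
        exact le_top.trans this
      · rw [← Ioc_union_Ioc_eq_Ioc h.le (hstep n),
          lintegral_union measurableSet_Ioc (Ioc_disjoint_Ioc_of_le le_rfl), add_comm]
        gcongr
        refine le_trans ?_ (aux_lower f hf0 hfmono (L (n+1)) (L n) (hδ.trans h))
        rw [ENNReal.le_div_iff_mul_le (Or.inl (by simpa using mul_pos hLn h0))
          (Or.inl ENNReal.ofReal_ne_top), one_mul]
        exact ENNReal.ofReal_le_ofReal (hrec n)
  intro n hn
  by_contra hlt
  push Not at hlt
  have h1 := (key n hlt).trans hn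
  have h2 := aux_lower f hf0 hfmono δ (L n) hδ
  have h3 : 0 < ENNReal.ofReal (L n - δ) / ENNReal.ofReal (L n * f (L n)) :=
    ENNReal.div_pos (by simpa using hlt) ENNReal.ofReal_ne_top
  have h4 := ENNReal.lt_add_right (ENNReal.natCast_ne_top n) (h3.trans_le h2).ne'
  exact absurd h1 (not_le.mpr h4)
end

section
/- Let f : [0,∞) → [0,1] be an increasing function such that u ↦ u f(u) is convex on (0,∞). Let (Z_n)_{n≥0} be nonnegative random variables with Z_0 = L_0 deterministic, satisfying E(Z_{n+1} | Z_n) ≤ Z_n (1 − f(Z_n)) for all n, and set L_n = E(Z_n). Then for every δ > 0 and every n ≥ ∫_δ^{L_0} dz/(z f(z)), one has L_n ≤ δ. -/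
open MeasureTheory Set
open scoped ENNReal

lemma conv_Ici (f : ℝ → ℝ) (hf0 : ∀ z, 0 ≤ z → 0 ≤ f z)
    (hfmono : MonotoneOn f (Ici (0 : ℝ)))
    (hconv : ConvexOn ℝ (Ioi (0 : ℝ)) fun u => u * f u) :
    ConvexOn ℝ (Ici (0 : ℝ)) fun u => u * f u := by
  have key : ∀ b y : ℝ, 0 ≤ b → b ≤ 1 → 0 ≤ y → b * y * f (b * y) ≤ b * (y * f y) := by
    intro b y hb hb1 hy
    have h1 : f (b * y) ≤ f y :=
      hfmono (mem_Ici.2 (mul_nonneg hb hy)) (mem_Ici.2 hy) (mul_le_of_le_one_left hy hb1)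
    nlinarith [mul_le_mul_of_nonneg_left h1 (mul_nonneg hb hy)]
  refine ⟨convex_Ici 0, ?_⟩
  intro x hx y hy a b ha hb hab
  rcases (mem_Ici.1 hx).eq_or_lt with h | h
  · subst h
    simpa using key b y hb (by linarith) hy
  rcases (mem_Ici.1 hy).eq_or_lt with h' | h'
  · subst h'
    simpa using key a x ha (by linarith) hx
  exact hconv.2 h h' ha hb hab

lemma cont_Ici (f : ℝ → ℝ) (hf0 : ∀ z, 0 ≤ z → 0 ≤ f z) (hf1 : ∀ z, 0 ≤ z → f z ≤ 1)
    (hconv : ConvexOn ℝ (Ioi (0 : ℝ)) fun u => u * f u) :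
    ContinuousOn (fun u => u * f u) (Ici (0 : ℝ)) := by
  have h := hconv.continuousOn isOpen_Ioi
  intro x hx
  rcases (mem_Ici.1 hx).eq_or_lt with h0 | h0
  · subst h0
    have h2 : Filter.Tendsto (fun u : ℝ => u) (nhdsWithin 0 (Ici 0)) (nhds 0) :=
      Filter.tendsto_id.mono_left nhdsWithin_le_nhds
    unfold ContinuousWithinAt
    simp only [zero_mul]
    refine tendsto_of_tendsto_of_tendsto_of_le_of_le' tendsto_const_nhds h2 ?_ ?_
    · filter_upwards [self_mem_nhdsWithin] with u hu
      exact mul_nonneg hu (hf0 u hu)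
    · filter_upwards [self_mem_nhdsWithin] with u hu
      exact mul_le_of_le_one_right hu (hf1 u hu)
  · exact (h.continuousAt (Ioi_mem_nhds h0)).continuousWithinAt

lemma step_le {Ω : Type*} [MeasurableSpace Ω] (μ : Measure Ω) [IsProbabilityMeasure μ]
    (f : ℝ → ℝ)
    (hf0 : ∀ z, 0 ≤ z → 0 ≤ f z) (hf1 : ∀ z, 0 ≤ z → f z ≤ 1)
    (hfmono : MonotoneOn f (Ici (0 : ℝ)))
    (hconv : ConvexOn ℝ (Ioi (0 : ℝ)) fun u => u * f u)
    (X Y : Ω → ℝ) (hX : Measurable X) (hXi : Integrable X μ)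
    (hX0 : ∀ ω, 0 ≤ X ω)
    (hcond : μ[Y | MeasurableSpace.comap X Real.measurableSpace] ≤ᵐ[μ]
        fun ω => X ω * (1 - f (X ω))) :
    ∫ ω, Y ω ∂μ ≤ (∫ ω, X ω ∂μ) - (∫ ω, X ω ∂μ) * f (∫ ω, X ω ∂μ) := by
  have hm : Monotone (fun u => f (max u 0)) := fun a b hab =>
    hfmono (mem_Ici.2 (le_max_right _ _)) (mem_Ici.2 (le_max_right _ _)) (max_le_max_right 0 hab)
  have hfX : Measurable (fun ω => f (X ω)) := by
    have := hm.measurable.comp hX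
    convert this using 2 with ω
    simp [max_eq_left (hX0 ω)]
  have hgi : Integrable (fun ω => X ω * f (X ω)) μ := by
    refine hXi.mono (hX.mul hfX).aestronglyMeasurable (Filter.Eventually.of_forall fun ω => ?_)
    rw [Real.norm_of_nonneg (mul_nonneg (hX0 ω) (hf0 _ (hX0 ω))), Real.norm_of_nonneg (hX0 ω)]
    exact mul_le_of_le_one_right (hX0 ω) (hf1 _ (hX0 ω))
  have hJ := (conv_Ici f hf0 hfmono hconv).map_integral_le (μ := μ) (f := X)
    (cont_Ici f hf0 hf1 hconv) isClosed_Ici (Filter.Eventually.of_forall hX0) hXi hgi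
  have h1 : ∫ ω, Y ω ∂μ ≤ ∫ ω, X ω * (1 - f (X ω)) ∂μ := by
    rw [← integral_condExp (μ := μ) (f := Y) hX.comap_le]
    refine integral_mono_ae integrable_condExp ?_ hcond
    convert hXi.sub hgi using 2 with ω
    simp; ring
  have h2 : ∫ ω, X ω * (1 - f (X ω)) ∂μ = (∫ ω, X ω ∂μ) - ∫ ω, X ω * f (X ω) ∂μ := by
    rw [← integral_sub hXi hgi]
    congr 1; ext ω; ring
  linarith

lemma int_step (f : ℝ → ℝ) (hf0 : ∀ z, 0 ≤ z → 0 ≤ f z)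
    (hfmono : MonotoneOn f (Ici (0 : ℝ))) (δ a b : ℝ) (hδ : 0 < δ) (ha : δ < a) (hb : 0 ≤ b)
    (hab : a ≤ b - b * f b) :
    1 + (∫⁻ z in Ioc δ a, 1 / ENNReal.ofReal (z * f z)) ≤
      ∫⁻ z in Ioc δ b, 1 / ENNReal.ofReal (z * f z) := by
  have hg : ∀ z w, 0 ≤ z → z ≤ w → z * f z ≤ w * f w := fun z w hz hzw =>
    mul_le_mul hzw (hfmono hz (mem_Ici.2 (hz.trans hzw)) hzw) (hf0 z hz) (hz.trans hzw)
  have hlow : ∀ c, 0 ≤ c → (1 / ENNReal.ofReal (b * f b)) * ENNReal.ofReal (b - c) ≤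
      ∫⁻ z in Ioc c b, 1 / ENNReal.ofReal (z * f z) := by
    intro c hc
    rw [← Real.volume_Ioc, ← setLIntegral_const]
    refine setLIntegral_mono' measurableSet_Ioc fun z hz => ?_
    exact ENNReal.div_le_div_left (ENNReal.ofReal_le_ofReal (hg z b (hc.trans hz.1.le) hz.2)) 1
  have hgb : 0 ≤ b * f b := mul_nonneg hb (hf0 b hb)
  have hab' : a ≤ b := by linarith
  rcases hgb.eq_or_lt with h0 | h0
  · have := hlow δ hδ.le
    rw [← h0, ENNReal.ofReal_zero, one_div, ENNReal.inv_zero, ENNReal.top_mul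
      (by simpa using ha.trans_le hab'), top_le_iff] at this
    rw [this]; exact le_top
  · rw [← Ioc_union_Ioc_eq_Ioc ha.le hab', lintegral_union measurableSet_Ioc
      (Ioc_disjoint_Ioc_of_le le_rfl), add_comm]
    gcongr
    refine le_trans ?_ (hlow a (by linarith))
    calc (1:ℝ≥0∞) = 1 / ENNReal.ofReal (b * f b) * ENNReal.ofReal (b * f b) := by
          rw [one_div, ENNReal.inv_mul_cancel (by simpa using h0) ENNReal.ofReal_ne_top]
      _ ≤ _ := by
          gcongr
          linarith

/-- Lemma (rr)(ii): if `f : [0,∞) → [0,1]` is increasing, `u ↦ u f(u)` is convex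
on `(0,∞)`, and the nonnegative random variables `(Z_n)` satisfy `Z_0 = L_0` and
`E(Z_{n+1} | Z_n) ≤ Z_n (1 - f(Z_n))`, then `L_n = E(Z_n) ≤ δ` for every
`n ≥ ∫_δ^{L_0} dz/(z f(z))`. -/
theorem expectation_le_of_integral_le
    {Ω : Type*} [MeasurableSpace Ω] (μ : Measure Ω) [IsProbabilityMeasure μ]
    (f : ℝ → ℝ)
    (hf0 : ∀ z, 0 ≤ z → 0 ≤ f z) (hf1 : ∀ z, 0 ≤ z → f z ≤ 1)
    (hfmono : MonotoneOn f (Ici (0 : ℝ)))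
    (hconv : ConvexOn ℝ (Ioi (0 : ℝ)) fun u => u * f u)
    (Z : ℕ → Ω → ℝ) (hZmeas : ∀ n, Measurable (Z n))
    (hZint : ∀ n, Integrable (Z n) μ) (hZ0 : ∀ n ω, 0 ≤ Z n ω)
    (L0 : ℝ) (hL0 : ∀ ω, Z 0 ω = L0)
    (hcond : ∀ n,
      μ[Z (n + 1) | MeasurableSpace.comap (Z n) Real.measurableSpace] ≤ᵐ[μ]
        fun ω => Z n ω * (1 - f (Z n ω)))
    (δ : ℝ) (hδ : 0 < δ) :
    ∀ n : ℕ,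
      (∫⁻ z in Ioc δ L0, 1 / ENNReal.ofReal (z * f z)) ≤ (n : ℝ≥0∞) →
      (∫ ω, Z n ω ∂μ) ≤ δ := by
  have hst : ∀ n, ∫ ω, Z (n+1) ω ∂μ ≤ (∫ ω, Z n ω ∂μ) - (∫ ω, Z n ω ∂μ) * f (∫ ω, Z n ω ∂μ) :=
    fun n => step_le μ f hf0 hf1 hfmono hconv (Z n) (Z (n+1)) (hZmeas n) (hZint n) (hZ0 n) (hcond n)
  have hpos : ∀ n, 0 ≤ ∫ ω, Z n ω ∂μ := fun n => integral_nonneg (hZ0 n)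
  have hL : ∫ ω, Z 0 ω ∂μ = L0 := by simp [hL0]
  have claim : ∀ n : ℕ, δ < ∫ ω, Z n ω ∂μ →
      (n : ℝ≥0∞) + (∫⁻ z in Ioc δ (∫ ω, Z n ω ∂μ), 1 / ENNReal.ofReal (z * f z)) ≤
      ∫⁻ z in Ioc δ L0, 1 / ENNReal.ofReal (z * f z) := by
    intro n
    induction n with
    | zero => intro _; rw [hL]; simp
    | succ k ih =>
      intro h
      have h1 := int_step f hf0 hfmono δ _ _ hδ h (hpos k) (hst k)
      have h2 := mul_nonneg (hpos k) (hf0 _ (hpos k))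
      refine le_trans ?_ (ih (by linarith [hst k]))
      push_cast
      rw [add_assoc]
      gcongr
  intro n hn
  by_contra! hlt
  have h1 := (claim n hlt).trans hn
  have h2 : (0:ℝ≥0∞) < ∫⁻ z in Ioc δ (∫ ω, Z n ω ∂μ), 1 / ENNReal.ofReal (z * f z) := by
    have hlow : (1 / ENNReal.ofReal (∫ ω, Z n ω ∂μ)) * volume (Ioc δ (∫ ω, Z n ω ∂μ)) ≤
        ∫⁻ z in Ioc δ (∫ ω, Z n ω ∂μ), 1 / ENNReal.ofReal (z * f z) := by
      rw [← setLIntegral_const]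
      refine setLIntegral_mono' measurableSet_Ioc fun z hz => ?_
      have hz0 : 0 ≤ z := hδ.le.trans hz.1.le
      gcongr
      exact (mul_le_of_le_one_right hz0 (hf1 z hz0)).trans hz.2
    refine lt_of_lt_of_le ?_ hlow
    rw [Real.volume_Ioc]
    refine ENNReal.mul_pos ?_ ?_
    · simp
    · simpa using hlt
  exact absurd h1 (not_le.2 (ENNReal.lt_add_right (ENNReal.natCast_ne_top n) h2.ne'))
end

section
/- Let f_0 : [0,∞) → [0,1] be an increasing function and define f(z) = f_0(z/2)/2. Let (Z_n)_{n≥0} be nonnegative random variables with Z_0 = L_0 deterministic, satisfying E(Z_{n+1} | Z_n) ≤ Z_n (1 − f_0(Z_n)) for all n, and set L_n = E(Z_n). Then for every δ > 0 and every n ≥ ∫_δ^{L_0} dz/(z f(z)), one has L_n ≤ δ. -/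
open MeasureTheory Set
open scoped ENNReal

/-- Lemma (rr)(iii): if `f₀ : [0,∞) → [0,1]` is increasing, `f(z) = f₀(z/2)/2`,
and the nonnegative random variables `(Z_n)` satisfy `Z_0 = L_0` and
`E(Z_{n+1} | Z_n) ≤ Z_n (1 - f₀(Z_n))`, then `L_n = E(Z_n) ≤ δ` for every
`n ≥ ∫_δ^{L_0} dz/(z f(z))`. -/
theorem expectation_le_of_integral_le'
    {Ω : Type*} [MeasurableSpace Ω] (μ : Measure Ω) [IsProbabilityMeasure μ]
    (f₀ : ℝ → ℝ)
    (hf0 : ∀ z, 0 ≤ z → 0 ≤ f₀ z) (hf1 : ∀ z, 0 ≤ z → f₀ z ≤ 1)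
    (hfmono : MonotoneOn f₀ (Ici (0 : ℝ)))
    (f : ℝ → ℝ) (hf : ∀ z, f z = f₀ (z / 2) / 2)
    (Z : ℕ → Ω → ℝ) (hZmeas : ∀ n, Measurable (Z n))
    (hZint : ∀ n, Integrable (Z n) μ) (hZ0 : ∀ n ω, 0 ≤ Z n ω)
    (L0 : ℝ) (hL0 : ∀ ω, Z 0 ω = L0)
    (hcond : ∀ n,
      μ[Z (n + 1) | MeasurableSpace.comap (Z n) Real.measurableSpace] ≤ᵐ[μ]
        fun ω => Z n ω * (1 - f₀ (Z n ω)))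
    (δ : ℝ) (hδ : 0 < δ) :
    ∀ n : ℕ,
      (∫⁻ z in Ioc δ L0, 1 / ENNReal.ofReal (z * f z)) ≤ (n : ℝ≥0∞) →
      (∫ ω, Z n ω ∂μ) ≤ δ := by
  have hfm : ∀ x y, 0 ≤ x → x ≤ y → f x ≤ f y := by
    intro x y hx hxy
    rw [hf, hf]
    have := hfmono (show x / 2 ∈ Ici (0:ℝ) from by simp only [mem_Ici]; linarith)
      (show y / 2 ∈ Ici (0:ℝ) from by simp only [mem_Ici]; linarith) (by linarith)
    linarith
  have hfn : ∀ x, 0 ≤ x → 0 ≤ f x := by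
    intro x hx
    rw [hf]
    have := hf0 (x / 2) (by linarith)
    linarith
  have hLn : ∀ n, 0 ≤ ∫ ω, Z n ω ∂μ := fun n => integral_nonneg (hZ0 n)
  have hstep : ∀ n, (∫ ω, Z (n+1) ω ∂μ) ≤
      (∫ ω, Z n ω ∂μ) - (∫ ω, Z n ω ∂μ) * f (∫ ω, Z n ω ∂μ) := by
    intro n
    have hL := hLn n
    set L := ∫ ω, Z n ω ∂μ with hLdef
    have hm : MeasurableSpace.comap (Z n) Real.measurableSpace ≤ ‹MeasurableSpace Ω› :=
      (hZmeas n).comap_le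
    have hmono : Monotone (fun x : ℝ => f₀ (max x 0)) := by
      intro x y hxy
      exact hfmono (by simp) (by simp) (max_le_max hxy le_rfl)
    have hmeas : Measurable (fun ω => f₀ (Z n ω)) := by
      have h := hmono.measurable.comp (hZmeas n)
      have e : (fun x : ℝ => f₀ (max x 0)) ∘ Z n = fun ω => f₀ (Z n ω) := by
        funext ω
        simp [hZ0 n ω]
      rwa [e] at h
    have hint : Integrable (fun ω => Z n ω * (1 - f₀ (Z n ω))) μ := by
      refine (hZint n).mono
        ((hZmeas n).mul (measurable_const.sub hmeas)).aestronglyMeasurable ?_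
      refine Filter.Eventually.of_forall fun ω => ?_
      have h0 := hZ0 n ω
      have h1 := hf0 _ h0
      have h2 := hf1 _ h0
      rw [Real.norm_eq_abs, Real.norm_eq_abs, abs_of_nonneg h0,
        abs_of_nonneg (mul_nonneg h0 (by linarith))]
      nlinarith
    have h1 : (∫ ω, Z (n+1) ω ∂μ) ≤ ∫ ω, Z n ω * (1 - f₀ (Z n ω)) ∂μ := by
      rw [← integral_condExp hm]
      exact integral_mono_ae integrable_condExp hint (hcond n)
    have h2 : (∫ ω, Z n ω * (1 - f₀ (Z n ω)) ∂μ) ≤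
        ∫ ω, (Z n ω - f₀ (L/2) * (Z n ω - L/2)) ∂μ := by
      refine integral_mono hint
        ((hZint n).sub (((hZint n).sub (integrable_const _)).const_mul _)) fun ω => ?_
      have h0 := hZ0 n ω
      have h1 := hf0 _ h0
      have h3 := hf0 (L/2) (by linarith)
      show Z n ω * (1 - f₀ (Z n ω)) ≤ Z n ω - f₀ (L/2) * (Z n ω - L/2)
      rcases le_total (L/2) (Z n ω) with h | h
      · have h4 := hfmono (show L / 2 ∈ Ici (0:ℝ) from by simp only [mem_Ici]; linarith)
          (show Z n ω ∈ Ici (0:ℝ) from h0) h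
        nlinarith [mul_nonneg h0 (sub_nonneg.2 h4), mul_nonneg h3 hL]
      · nlinarith [mul_nonneg h3 (sub_nonneg.2 h), mul_nonneg h0 h1]
    have h3 : ∫ ω, (Z n ω - f₀ (L/2) * (Z n ω - L/2)) ∂μ = L - L * f L := by
      have hi : Integrable (fun ω => f₀ (L/2) * (Z n ω - L/2)) μ :=
        ((hZint n).sub (integrable_const _)).const_mul _
      rw [integral_sub (hZint n) hi,
        integral_const_mul, integral_sub (hZint n) (integrable_const _), ← hLdef, hf]
      simp
      ring
    linarith
  have hlow : ∀ a b : ℝ, 0 ≤ a →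
      ENNReal.ofReal (b - a) / ENNReal.ofReal (b * f b) ≤
        ∫⁻ z in Ioc a b, 1 / ENNReal.ofReal (z * f z) := by
    intro a b ha
    calc ENNReal.ofReal (b - a) / ENNReal.ofReal (b * f b)
        = ∫⁻ z in Ioc a b, 1 / ENNReal.ofReal (b * f b) := by
          rw [setLIntegral_const, Real.volume_Ioc, one_div, mul_comm, ENNReal.div_eq_inv_mul]
      _ ≤ _ := by
          refine setLIntegral_mono' measurableSet_Ioc fun z hz => ?_
          refine ENNReal.div_le_div_left (ENNReal.ofReal_le_ofReal ?_) _
          have hz0 : 0 ≤ z := ha.trans hz.1.le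
          exact mul_le_mul hz.2 (hfm z b hz0 hz.2) (hfn z hz0) (hz0.trans hz.2)
  have hdec : ∀ n, (∫ ω, Z (n+1) ω ∂μ) ≤ ∫ ω, Z n ω ∂μ := fun n => by
    have := hstep n
    have := mul_nonneg (hLn n) (hfn _ (hLn n))
    linarith
  have main : ∀ n : ℕ, δ < (∫ ω, Z n ω ∂μ) →
      (n : ℝ≥0∞) + (∫⁻ z in Ioc δ (∫ ω, Z n ω ∂μ), 1 / ENNReal.ofReal (z * f z)) ≤
        ∫⁻ z in Ioc δ L0, 1 / ENNReal.ofReal (z * f z) := by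
    intro n
    induction n with
    | zero =>
      intro _
      have : ∫ ω, Z 0 ω ∂μ = L0 := by simp [hL0]
      rw [this]
      simp
    | succ n ih =>
      intro h
      have hd := hdec n
      have hs := hstep n
      have hn := hLn n
      refine le_trans ?_ (ih (h.trans_le hd))
      generalize (∫ ω, Z (n+1) ω ∂μ) = M at *
      generalize (∫ ω, Z n ω ∂μ) = L at *
      push_cast
      rw [add_assoc]
      gcongr
      rcases (mul_nonneg hn (hfn L hn)).eq_or_lt with h0 | h0
      · have := hlow δ L hδ.le
        rw [← h0, ENNReal.ofReal_zero, ENNReal.div_zero] at this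
        · rw [top_le_iff.1 this]
          exact le_top
        · simp only [ne_eq, ENNReal.ofReal_eq_zero, not_le]
          linarith
      · rw [← Ioc_union_Ioc_eq_Ioc h.le hd, lintegral_union measurableSet_Ioc
          (Ioc_disjoint_Ioc_of_le le_rfl), add_comm]
        gcongr
        refine le_trans ?_ (hlow M L (hδ.le.trans h.le))
        rw [ENNReal.le_div_iff_mul_le (Or.inl (by simpa using h0)) (Or.inl (by simp)), one_mul]
        exact ENNReal.ofReal_le_ofReal (by linarith)
  intro n hn
  by_contra! hc
  have h1 := (main n hc).trans hn
  have h2 := hlow δ (∫ ω, Z n ω ∂μ) hδ.le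
  have h3 : (n : ℝ≥0∞) + (∫⁻ z in Ioc δ (∫ ω, Z n ω ∂μ), 1 / ENNReal.ofReal (z * f z))
      ≤ n + 0 := by simpa using h1
  have h4 := (ENNReal.add_le_add_iff_left (ENNReal.natCast_ne_top n)).1 h3
  have h5 := le_antisymm (h2.trans h4) (zero_le)
  rw [ENNReal.div_eq_zero_iff] at h5
  rcases h5 with h5 | h5
  · rw [ENNReal.ofReal_eq_zero] at h5
    linarith
  · exact ENNReal.ofReal_ne_top h5
end

section
/- Let Z ≥ 0 be a nonnegative random variable and let f be a nonnegative increasing function. Then E(Z f(2Z)) ≥ (E(Z)/2) · f(E(Z)). -/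
open MeasureTheory Set
open scoped ENNReal

/-- Lemma (l8): for a nonnegative random variable `Z` and a nonnegative
increasing function `f`, `E(Z f(2Z)) ≥ (E Z / 2) f(E Z)`. -/
theorem lintegral_mul_comp_ge
    {Ω : Type*} [MeasurableSpace Ω] (μ : Measure Ω) [IsProbabilityMeasure μ]
    (Z : Ω → ℝ) (hZmeas : Measurable Z) (hZ0 : ∀ ω, 0 ≤ Z ω)
    (hZint : Integrable Z μ)
    (f : ℝ → ℝ) (hf0 : ∀ z, 0 ≤ z → 0 ≤ f z)
    (hfmono : MonotoneOn f (Ici (0 : ℝ))) :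
    ENNReal.ofReal ((∫ ω, Z ω ∂μ) / 2 * f (∫ ω, Z ω ∂μ)) ≤
      ∫⁻ ω, ENNReal.ofReal (Z ω * f (2 * Z ω)) ∂μ := by
  set m := ∫ ω, Z ω ∂μ with hm
  have hm0 : 0 ≤ m := integral_nonneg hZ0
  have hfm : 0 ≤ f m := hf0 m hm0
  have hg : Integrable (fun ω => (Z ω - m / 2) * f m) μ :=
    (hZint.sub (integrable_const _)).mul_const _
  have hgp : Integrable (fun ω => max ((Z ω - m / 2) * f m) 0) μ := hg.pos_part
  have h1 : ∫ ω, (Z ω - m / 2) * f m ∂μ = m / 2 * f m := by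
    rw [integral_mul_const, integral_sub hZint (integrable_const _), ← hm]
    simp
    left
    ring
  have h2 : m / 2 * f m ≤ ∫ ω, max ((Z ω - m / 2) * f m) 0 ∂μ := by
    rw [← h1]
    exact integral_mono hg hgp (fun ω => le_max_left _ _)
  refine (ENNReal.ofReal_le_ofReal h2).trans ?_
  rw [ofReal_integral_eq_lintegral_ofReal hgp
    (Filter.Eventually.of_forall fun ω => le_max_right _ _)]
  refine lintegral_mono fun ω => ENNReal.ofReal_le_ofReal ?_
  have hz := hZ0 ω
  have hz2 : 0 ≤ 2 * Z ω := by linarith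
  have hf2 := hf0 _ hz2
  refine max_le ?_ (mul_nonneg hz hf2)
  rcases le_total m (2 * Z ω) with h | h
  · have h3 : f m ≤ f (2 * Z ω) := hfmono hm0 hz2 h
    exact mul_le_mul (by linarith) h3 hfm hz
  · exact (mul_nonpos_of_nonpos_of_nonneg (by linarith) hfm).trans (mul_nonneg hz hf2)
end
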